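/- arXiv:1710.08403 — 3 statements merged into one kernel-verified Lean document; each statement's English description precedes it below -/
import Mathlib

section
/- (Bzdęga's bound) Let 3 ≤ p < q < r be primes. Let q* and r* be the inverses of q and r modulo p with 1 ≤ q*, r* ≤ p-1, set a = min(q*, r*, p-q*, p-r*), and let d be the unique integer with 1 ≤ d ≤ p-1 and a·d·q·r ≡ 1 (mod p). Then every coefficient a_{pqr}(k) of the cyclotomic polynomial Φ_{pqr} satisfies -min(p + 2a - d, d) ≤ a_{pqr}(k) ≤ min(2a + d, p - d). -/
open Polynomial in
/-- The product of the three geometric polynomials. -/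
noncomputable def bzT (p q r : ℕ) : ℤ[X] :=
  (∑ a ∈ Finset.range p, X ^ (a * (q * r))) * (∑ b ∈ Finset.range q, X ^ (b * (p * r))) *
    (∑ c ∈ Finset.range r, X ^ (c * (p * q)))

/-- Its coefficients, extended by zero to the integers. -/
noncomputable def bzChi (p q r : ℕ) (x : ℤ) : ℤ :=
  if 0 ≤ x then (bzT p q r).coeff x.toNat else 0

/-- Normalized representation of an integer. -/
def bzRep (p q r x a b c m : ℤ) : Prop :=
  (0 ≤ a ∧ a < p) ∧ (0 ≤ b ∧ b < q) ∧ (0 ≤ c ∧ c < r) ∧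
    x = a * (q * r) + b * (p * r) + c * (p * q) + m * (p * q * r)

open Polynomial in
theorem bz_cyclo_identity (p q r : ℕ) (hp : p.Prime) (hq : q.Prime) (hr : r.Prime)
    (hpq : p ≠ q) (hpr : p ≠ r) (hqr : q ≠ r) :
    cyclotomic (p * q * r) ℤ * (X ^ (p * q * r) - 1) ^ 2 =
      bzT p q r * (∑ i ∈ Finset.range p, X ^ i) * (X ^ q - 1) * (X ^ r - 1) := by
  have := Fact.mk hp
  have h1 : cyclotomic p ℤ * (X - 1) = X ^ p - 1 := cyclotomic_prime_mul_X_sub_one ℤ p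
  have hqp : ¬ q ∣ p := fun h => hpq ((Nat.prime_dvd_prime_iff_eq hq hp).1 h).symm
  have hrp : ¬ r ∣ p := fun h => hpr ((Nat.prime_dvd_prime_iff_eq hr hp).1 h).symm
  have hrq : ¬ r ∣ q := fun h => hqr ((Nat.prime_dvd_prime_iff_eq hr hq).1 h).symm
  have hrpq : ¬ r ∣ p * q := fun h => ((Nat.Prime.dvd_mul hr).1 h).elim hrp hrq
  have e1 := cyclotomic_expand_eq_cyclotomic_mul hq hqp ℤ
  have e2 := cyclotomic_expand_eq_cyclotomic_mul hr hrp ℤ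
  have e3 := cyclotomic_expand_eq_cyclotomic_mul hr hrpq ℤ
  have h2 : cyclotomic (p * q) ℤ * cyclotomic p ℤ * (X ^ q - 1) = X ^ (p * q) - 1 := by
    have := congrArg (expand ℤ q) h1
    simp only [map_mul, map_sub, map_pow, expand_X, map_one] at this
    rw [e1] at this
    rw [this, ← pow_mul, mul_comm q p]
  have h3 : cyclotomic (p * r) ℤ * cyclotomic p ℤ * (X ^ r - 1) = X ^ (p * r) - 1 := by
    have := congrArg (expand ℤ r) h1
    simp only [map_mul, map_sub, map_pow, expand_X, map_one] at this
    rw [e2] at this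
    rw [this, ← pow_mul, mul_comm r p]
  have h4 : cyclotomic (p * q * r) ℤ * cyclotomic (p * q) ℤ *
      (cyclotomic (p * r) ℤ * cyclotomic p ℤ) * (X ^ (q * r) - 1) = X ^ (p * q * r) - 1 := by
    have := congrArg (expand ℤ r) h2
    simp only [map_mul, map_sub, map_pow, expand_X, map_one] at this
    rw [e2, e3, ← pow_mul, ← pow_mul] at this
    rw [mul_comm q r, this]
    congr 2
    ring
  have hpos := hp.pos
  have hqos := hq.pos
  have hros := hr.pos
  have g1 : (∑ a ∈ Finset.range p, (X : ℤ[X]) ^ (a * (q * r))) * (X ^ (q * r) - 1)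
      = X ^ (p * q * r) - 1 := by
    have := geom_sum_mul ((X : ℤ[X]) ^ (q * r)) p
    simp only [← pow_mul] at this
    simp only [mul_comm _ (q * r)]
    rw [this]; congr 2; ring
  have g2 : (∑ a ∈ Finset.range q, (X : ℤ[X]) ^ (a * (p * r))) * (X ^ (p * r) - 1)
      = X ^ (p * q * r) - 1 := by
    have := geom_sum_mul ((X : ℤ[X]) ^ (p * r)) q
    simp only [← pow_mul] at this
    simp only [mul_comm _ (p * r)]
    rw [this]; congr 2; ring
  have g3 : (∑ a ∈ Finset.range r, (X : ℤ[X]) ^ (a * (p * q))) * (X ^ (p * q) - 1)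
      = X ^ (p * q * r) - 1 := by
    have := geom_sum_mul ((X : ℤ[X]) ^ (p * q)) r
    simp only [← pow_mul] at this
    simp only [mul_comm _ (p * q)]
    rw [this]
  rw [← cyclotomic_prime ℤ p]
  unfold bzT
  have n1 : cyclotomic p ℤ ≠ 0 := cyclotomic_ne_zero _ _
  have n2 : cyclotomic (p * q) ℤ ≠ 0 := cyclotomic_ne_zero _ _
  have n3 : cyclotomic (p * r) ℤ ≠ 0 := cyclotomic_ne_zero _ _
  have n4 : ((X : ℤ[X]) ^ (q * r) - 1) ≠ 0 :=
    X_pow_sub_C_ne_zero (Nat.mul_pos hqos hros) 1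
  have n5 : ((X : ℤ[X]) ^ (p * q) - 1) ≠ 0 :=
    X_pow_sub_C_ne_zero (Nat.mul_pos hpos hqos) 1
  have n6 : ((X : ℤ[X]) ^ (p * r) - 1) ≠ 0 :=
    X_pow_sub_C_ne_zero (Nat.mul_pos hpos hros) 1
  generalize (∑ a ∈ Finset.range p, (X : ℤ[X]) ^ (a * (q * r))) = A at *
  generalize (∑ a ∈ Finset.range q, (X : ℤ[X]) ^ (a * (p * r))) = B at *
  generalize (∑ a ∈ Finset.range r, (X : ℤ[X]) ^ (a * (p * q))) = C at *
  generalize cyclotomic p ℤ = P1 at *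
  generalize cyclotomic (p * q) ℤ = P2 at *
  generalize cyclotomic (p * r) ℤ = P3 at *
  generalize cyclotomic (p * q * r) ℤ = P4 at *
  generalize (X : ℤ[X]) ^ (p * q * r) - 1 = Z at *
  generalize (X : ℤ[X]) ^ (p * q) - 1 = Zr at *
  generalize (X : ℤ[X]) ^ (p * r) - 1 = Zq at *
  generalize (X : ℤ[X]) ^ (q * r) - 1 = Zp at *
  generalize (X : ℤ[X]) ^ q - 1 = Yq at *
  generalize (X : ℤ[X]) ^ r - 1 = Yr at *
  have hne : Zp * Zq * Zr * (P1 * P2 * P3) ≠ 0 := by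
    simp [*]
  apply mul_right_cancel₀ hne
  calc P4 * Z ^ 2 * (Zp * Zq * Zr * (P1 * P2 * P3))
      = (P4 * P2 * (P3 * P1) * Zp) * Z ^ 2 * Zq * Zr := by ring
    _ = Z * Z * Z * Zq * Zr := by rw [h4]; ring
    _ = (A * Zp) * (B * Zq) * (C * Zr) * (P3 * P1 * Yr) * (P2 * P1 * Yq) := by
        rw [g1, g2, g3, h2, h3]
    _ = _ := by ring

open Polynomial in
theorem bz_coeff_shift (p q r s k : ℕ) :
    (bzT p q r * X ^ s).coeff k = bzChi p q r ((k : ℤ) - s) := by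
  rw [coeff_mul_X_pow']
  unfold bzChi
  by_cases h : s ≤ k
  · rw [if_pos h, if_pos (by omega)]
    congr 1
    omega
  · rw [if_neg h, if_neg (by omega)]

open Polynomial in
theorem bz_coeff_formula (p q r : ℕ) (hp : p.Prime) (hq : q.Prime) (hr : r.Prime)
    (hpq : p ≠ q) (hpr : p ≠ r) (hqr : q ≠ r) (k : ℕ) (hk : k < p * q * r) :
    (cyclotomic (p * q * r) ℤ).coeff k = ∑ i ∈ Finset.range p,
      (bzChi p q r ((k : ℤ) - i) - bzChi p q r ((k : ℤ) - i - q) - bzChi p q r ((k : ℤ) - i - r)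
        + bzChi p q r ((k : ℤ) - i - q - r)) := by
  have h := bz_cyclo_identity p q r hp hq hr hpq hpr hqr
  have h1 : (cyclotomic (p * q * r) ℤ * (X ^ (p * q * r) - 1) ^ 2).coeff k
      = (cyclotomic (p * q * r) ℤ).coeff k := by
    have : cyclotomic (p * q * r) ℤ * (X ^ (p * q * r) - 1) ^ 2 = cyclotomic (p * q * r) ℤ
      + (cyclotomic (p * q * r) ℤ * (X ^ (p * q * r) - 2)) * X ^ (p * q * r) := by ring
    rw [this, coeff_add, coeff_mul_X_pow', if_neg (by omega), add_zero]
  have h2 : bzT p q r * (∑ i ∈ Finset.range p, X ^ i) * (X ^ q - 1) * (X ^ r - 1)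
      = ∑ i ∈ Finset.range p, (bzT p q r * X ^ i - bzT p q r * X ^ (i + q)
        - bzT p q r * X ^ (i + r) + bzT p q r * X ^ (i + q + r)) := by
    rw [Finset.mul_sum, Finset.sum_mul, Finset.sum_mul]
    refine Finset.sum_congr rfl fun i _ => ?_
    ring
  rw [← h1, h, h2, finsetSum_coeff]
  refine Finset.sum_congr rfl fun i _ => ?_
  simp only [coeff_add, coeff_sub, bz_coeff_shift]
  push_cast
  simp only [sub_sub, add_assoc]

theorem bz_rep_unique {p q r x a b c m a' b' c' m' : ℤ}
    (h1 : IsCoprime p q) (h2 : IsCoprime p r)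
    (h : bzRep p q r x a b c m) (h' : bzRep p q r x a' b' c' m') : a = a' := by
  obtain ⟨⟨ha, ha2⟩, -, -, hx⟩ := h
  obtain ⟨⟨ha', ha2'⟩, -, -, hx'⟩ := h'
  have hd : p ∣ (a - a') * (q * r) := by
    refine ⟨(b' - b) * r + (c' - c) * q + (m' - m) * (q * r), ?_⟩
    linear_combination hx' - hx
  have := (h1.mul_right h2).dvd_of_dvd_mul_right hd
  have := Int.eq_zero_of_abs_lt_dvd this (by rw [abs_lt]; omega)
  omega

theorem bz_rep_unique_all {p q r x a b c m a' b' c' m' : ℤ}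
    (hp : 0 < p) (hq : 0 < q) (hr : 0 < r)
    (h1 : IsCoprime p q) (h2 : IsCoprime p r) (h3 : IsCoprime q r)
    (h : bzRep p q r x a b c m) (h' : bzRep p q r x a' b' c' m') :
    a = a' ∧ b = b' ∧ c = c' ∧ m = m' := by
  have ea := bz_rep_unique h1 h2 h h'
  have eb : b = b' := by
    refine bz_rep_unique (p := q) (q := p) (r := r) (x := x) (b := a) (c := c) (m := m) (b' := a')
      (c' := c') (m' := m') h1.symm h3 ?_ ?_
    · obtain ⟨k1, k2, k3, k4⟩ := h
      exact ⟨k2, k1, k3, by rw [k4]; ring⟩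
    · obtain ⟨k1, k2, k3, k4⟩ := h'
      exact ⟨k2, k1, k3, by rw [k4]; ring⟩
  have ec : c = c' := by
    refine bz_rep_unique (p := r) (q := p) (r := q) (x := x) (b := a) (c := b) (m := m) (b' := a')
      (c' := b') (m' := m') h2.symm h3.symm ?_ ?_
    · obtain ⟨k1, k2, k3, k4⟩ := h
      exact ⟨k3, k1, k2, by rw [k4]; ring⟩
    · obtain ⟨k1, k2, k3, k4⟩ := h'
      exact ⟨k3, k1, k2, by rw [k4]; ring⟩
  refine ⟨ea, eb, ec, ?_⟩
  have e1 := h.2.2.2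
  have e2 := h'.2.2.2
  subst ea eb ec
  have hpos : 0 < p * q * r := by positivity
  apply mul_right_cancel₀ hpos.ne'
  linarith

open Polynomial in
theorem bz_chi_eq (p q r : ℕ) (hp : 0 < p) (hq : 0 < q) (hr : 0 < r)
    (h1 : IsCoprime (p : ℤ) q) (h2 : IsCoprime (p : ℤ) r) (h3 : IsCoprime (q : ℤ) r)
    {x a b c m : ℤ} (h : bzRep p q r x a b c m) (hm : m ≤ 0) :
    bzChi p q r x = if m = 0 then 1 else 0 := by
  have hT : bzT p q r = ∑ t ∈ Finset.range p ×ˢ Finset.range q ×ˢ Finset.range r,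
      X ^ (t.1 * (q * r) + t.2.1 * (p * r) + t.2.2 * (p * q)) := by
    unfold bzT
    rw [Finset.sum_product, mul_assoc, Finset.sum_mul]
    refine Finset.sum_congr rfl fun a _ => ?_
    rw [Finset.sum_product, Finset.sum_mul, Finset.mul_sum]
    refine Finset.sum_congr rfl fun b _ => ?_
    rw [Finset.mul_sum, Finset.mul_sum]
    refine Finset.sum_congr rfl fun c _ => ?_
    rw [pow_add, pow_add, mul_assoc]
  have hP : (0 : ℤ) < p * q * r := by positivity
  unfold bzChi
  by_cases hx : 0 ≤ x
  · rw [if_pos hx, hT, finsetSum_coeff]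
    simp only [coeff_X_pow]
    have key : ∀ t ∈ Finset.range p ×ˢ Finset.range q ×ˢ Finset.range r,
        x.toNat = t.1 * (q * r) + t.2.1 * (p * r) + t.2.2 * (p * q) →
        a = t.1 ∧ b = t.2.1 ∧ c = t.2.2 ∧ m = 0 := by
      intro t ht hxt
      simp only [Finset.mem_product, Finset.mem_range] at ht
      refine bz_rep_unique_all (by exact_mod_cast hp) (by exact_mod_cast hq)
        (by exact_mod_cast hr) h1 h2 h3 h ⟨by omega, by omega, by omega, ?_⟩
      have : ((x.toNat : ℕ) : ℤ) = x := Int.toNat_of_nonneg hx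
      rw [← this, hxt]
      push_cast
      ring
    by_cases hm0 : m = 0
    · rw [if_pos hm0]
      obtain ⟨k1, k2, k3, k4⟩ := h
      rw [Finset.sum_eq_single (a.toNat, b.toNat, c.toNat)]
      · rw [if_pos]
        zify
        simp only [Int.toNat_of_nonneg, hx, k1.1, k2.1, k3.1]
        rw [k4, hm0]; ring
      · intro t ht hne
        rw [if_neg]
        intro hxt
        obtain ⟨e1, e2, e3, -⟩ := key t ht hxt
        apply hne
        ext <;> simp <;> omega
      · intro hn
        exfalso
        apply hn
        simp only [Finset.mem_product, Finset.mem_range]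
        omega
    · rw [if_neg hm0]
      apply Finset.sum_eq_zero
      intro t ht
      rw [if_neg]
      intro hxt
      exact hm0 (key t ht hxt).2.2.2
  · rw [if_neg hx, if_neg]
    rintro rfl
    obtain ⟨⟨k1, _⟩, ⟨k2, _⟩, ⟨k3, _⟩, k4⟩ := h
    apply hx
    rw [k4]
    positivity

theorem bz_rep_exists {p q r : ℤ} (hp : 0 < p) (hq : 0 < q) (hr : 0 < r)
    (h1 : IsCoprime p q) (h2 : IsCoprime p r) (h3 : IsCoprime q r) (x : ℤ) :
    ∃ a b c m, bzRep p q r x a b c m := by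
  have main : ∀ p q r : ℤ, 0 < p → IsCoprime p q → IsCoprime p r →
      ∃ a, (0 ≤ a ∧ a < p) ∧ p ∣ x - a * (q * r) := by
    intro p q r hp h1 h2
    obtain ⟨u, v, huv⟩ := h1.mul_right h2
    refine ⟨(x * v) % p, ⟨Int.emod_nonneg _ hp.ne', Int.emod_lt_of_pos _ hp⟩, ?_⟩
    have := Int.emod_add_mul_ediv (x * v) p
    refine ⟨x * u + (x * v / p) * (q * r), ?_⟩
    linear_combination (-x) * huv - (q * r) * this
  obtain ⟨a, ha, da⟩ := main p q r hp h1 h2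
  obtain ⟨b, hb, db⟩ := main q p r hq h1.symm h3
  obtain ⟨c, hc, dc⟩ := main r p q hr h2.symm h3.symm
  have d : p * q * r ∣ x - a * (q * r) - b * (p * r) - c * (p * q) := by
    refine IsCoprime.mul_dvd (h2.mul_left h3) (h1.mul_dvd ?_ ?_) ?_
    · obtain ⟨t, ht⟩ := da
      exact ⟨t - b * r - c * q, by linear_combination ht⟩
    · obtain ⟨t, ht⟩ := db
      exact ⟨t - a * r - c * p, by linear_combination ht⟩
    · obtain ⟨t, ht⟩ := dc
      exact ⟨t - a * q - b * p, by linear_combination ht⟩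
  obtain ⟨m, hm⟩ := d
  exact ⟨a, b, c, m, ha, hb, hc, by linear_combination hm⟩

theorem bz_rep_swap {p q r x a b c m : ℤ} (h : bzRep p q r x a b c m) :
    bzRep p r q x a c b m := by
  obtain ⟨k1, k2, k3, k4⟩ := h
  exact ⟨k1, k3, k2, by rw [k4]; ring⟩

theorem bz_rep_step {p q r x a b c m s R ρ : ℤ} (hR0 : 0 ≤ R) (hR : R ≤ p) (hρ0 : 0 ≤ ρ)
    (hρ : ρ ≤ r) (hRρ : r * R + p * ρ = p * r + s) (h : bzRep p q r x a b c m) :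
    bzRep p q r (x - s * q) (if a < R then a - R + p else a - R) b
      (if c < ρ then c - ρ + r else c - ρ)
      (m + 1 - (if a < R then 1 else 0) - (if c < ρ then 1 else 0)) := by
  obtain ⟨k1, k2, k3, k4⟩ := h
  refine ⟨by split_ifs <;> omega, k2, by split_ifs <;> omega, ?_⟩
  split_ifs <;> linear_combination k4 + q * hRρ

theorem bz_rep_m {p q r x a b c m : ℤ} (hp : 1 < p) (hq : 1 < q) (hr : 1 < r)
    (h : bzRep p q r x a b c m) (hx : -(p + q + r) ≤ x) (hx2 : x < p * q * r) :
    -2 ≤ m ∧ m ≤ 0 := by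
  obtain ⟨⟨a1, a2⟩, ⟨b1, b2⟩, ⟨c1, c2⟩, k4⟩ := h
  have hpq : 0 < p * q := by positivity
  have hpr : 0 < p * r := by positivity
  have hqr : 0 < q * r := by positivity
  have hP : 0 < p * q * r := by positivity
  have A : a * (q * r) ≤ (p - 1) * (q * r) := by gcongr; omega
  have B : b * (p * r) ≤ (q - 1) * (p * r) := by gcongr; omega
  have C : c * (p * q) ≤ (r - 1) * (p * q) := by gcongr; omega
  have A0 : 0 ≤ a * (q * r) := by positivity
  have B0 : 0 ≤ b * (p * r) := by positivity
  have C0 : 0 ≤ c * (p * q) := by positivity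
  constructor
  · by_contra hm
    have : m * (p * q * r) ≤ (-3) * (p * q * r) := by gcongr; omega
    nlinarith [mul_pos (sub_pos.2 hp) (sub_pos.2 hq), mul_pos (sub_pos.2 hp) (sub_pos.2 hr),
      mul_pos (sub_pos.2 hq) (sub_pos.2 hr)]
  · by_contra hm
    have : 1 * (p * q * r) ≤ m * (p * q * r) := by gcongr; omega
    nlinarith

set_option maxHeartbeats 4000000 in
theorem bz_point (p q r : ℕ) (hp : 1 < p) (hq : 1 < q) (hr : 1 < r)
    (h1 : IsCoprime (p : ℤ) q) (h2 : IsCoprime (p : ℤ) r) (h3 : IsCoprime (q : ℤ) r)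
    {s Q R π ρ : ℤ} (hQ0 : 1 ≤ Q) (hQR : Q ≤ R) (hQRp : Q + R ≤ p)
    (hπ0 : 0 ≤ π) (hπ : π ≤ q) (hρ0 : 0 ≤ ρ) (hρ : ρ ≤ r)
    (hQπ : q * Q + p * π = p * q + s) (hRρ : r * R + p * ρ = p * r + s)
    {x a b c m : ℤ} (h : bzRep p q r x a b c m)
    (b1 : ∀ y : ℤ, y = x ∨ y = x - s * q ∨ y = x - s * r ∨ y = x - s * q - s * r →
      -((p : ℤ) + q + r) ≤ y ∧ y < p * q * r) :
    ∃ e : ℤ, bzChi p q r x - bzChi p q r (x - s * q) - bzChi p q r (x - s * r)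
        + bzChi p q r (x - s * q - s * r) = e ∧
      (e ≤ 0 ∨ e = 1 ∧ (a < Q ∨ (Q + R ≤ a ∧ π ≤ b ∧ ρ ≤ c ∧ m = -2))) ∧
      (0 ≤ e ∨ e = -1 ∧ (R ≤ a ∧ a < Q + R ∨ (Q ≤ a ∧ a < R ∧ π ≤ b ∧ c < ρ ∧ m = -1))) := by
  have hp' : (1 : ℤ) < p := by exact_mod_cast hp
  have hq' : (1 : ℤ) < q := by exact_mod_cast hq
  have hr' : (1 : ℤ) < r := by exact_mod_cast hr
  have r2 := bz_rep_step (by omega) (by omega) hρ0 hρ hRρ h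
  have r3 := bz_rep_swap (bz_rep_step (by omega) (by omega) hπ0 hπ hQπ (bz_rep_swap h))
  have r4 := bz_rep_swap (bz_rep_step (by omega) (by omega) hπ0 hπ hQπ (bz_rep_swap r2))
  have m1 := bz_rep_m hp' hq' hr' h (b1 _ (by simp)).1 (b1 _ (by simp)).2
  have m2 := bz_rep_m hp' hq' hr' r2 (b1 _ (by simp)).1 (b1 _ (by simp)).2
  have m3 := bz_rep_m hp' hq' hr' r3 (b1 _ (by simp)).1 (b1 _ (by simp)).2
  have m4 := bz_rep_m hp' hq' hr' r4 (b1 _ (by simp)).1 (b1 _ (by simp)).2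
  refine ⟨_, rfl, ?_⟩
  rw [bz_chi_eq p q r (by omega) (by omega) (by omega) h1 h2 h3 h m1.2,
    bz_chi_eq p q r (by omega) (by omega) (by omega) h1 h2 h3 r2 m2.2,
    bz_chi_eq p q r (by omega) (by omega) (by omega) h1 h2 h3 r3 m3.2,
    bz_chi_eq p q r (by omega) (by omega) (by omega) h1 h2 h3 r4 m4.2]
  have ha := h.1
  clear r2 r3 r4 b1 h hQπ hRρ h1 h2 h3
  by_cases c1 : a < R <;> by_cases c2 : a < Q <;> by_cases c3 : c < ρ <;> by_cases c4 : b < π <;>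
    simp only [c1, c2, c3, c4, if_true, if_false, true_or, and_true, true_and,
      false_or, or_false, and_false, false_and] at m2 m3 m4 ⊢ <;>
    by_cases c5 : a < Q + R <;>
    split_ifs at m4 ⊢ <;> omega

theorem bz_count (n : ℕ) (e f : ℕ → ℤ) (S : Finset ℤ)
    (hinj : ∀ i < n, ∀ j < n, f i = f j → i = j)
    (he : ∀ i < n, e i ≤ 0 ∨ e i = 1 ∧ f i ∈ S) :
    ∑ i ∈ Finset.range n, e i ≤ S.card := by
  have h1 : ∑ i ∈ Finset.range n, e i ≤ ∑ i ∈ Finset.range n, if f i ∈ S then (1 : ℤ) else 0 := by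
    apply Finset.sum_le_sum
    intro i hi
    rcases he i (Finset.mem_range.1 hi) with h | ⟨h, h'⟩
    · split_ifs <;> omega
    · rw [if_pos h', h]
  refine h1.trans ?_
  rw [← Finset.sum_filter, Finset.sum_const, nsmul_eq_mul, mul_one]
  have : (Finset.filter (fun i => f i ∈ S) (Finset.range n)).card ≤ S.card := by
    apply Finset.card_le_card_of_injOn f
    · intro i hi
      simp only [Finset.coe_filter, Set.mem_ofPred_eq] at hi
      exact hi.2
    · intro i hi j hj hij
      simp only [Finset.coe_filter, Set.mem_ofPred_eq, Finset.mem_range] at hi hj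
      exact hinj i hi.1 j hj.1 hij
  exact_mod_cast this

theorem bz_interval (M lo hi w : ℤ) (hM : 0 < M) (hw : hi < lo + M * w) :
    ∃ L : ℤ, ∀ a, lo ≤ a * M → a * M ≤ hi → a ∈ Finset.Ico L (L + w) := by
  refine ⟨-((-lo) / M), fun a h1 h2 => ?_⟩
  have e1 := Int.emod_add_mul_ediv (-lo) M
  have e2 := Int.emod_nonneg (-lo) hM.ne'
  have e3 := Int.emod_lt_of_pos (-lo) hM
  rw [Finset.mem_Ico]
  set t := (-lo) / M
  constructor
  · by_contra hc
    have : a * M ≤ (-t - 1) * M := by gcongr; omega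
    nlinarith
  · by_contra hc
    have : (-t + w) * M ≤ a * M := by gcongr; omega
    nlinarith

theorem bz_core (p q r : ℕ) (hp : p.Prime) (hq : q.Prime) (hr : r.Prime)
    (hpq : p ≠ q) (hpr : p ≠ r) (hqr : q ≠ r) (s Q R : ℤ) (hs : s = 1 ∨ s = -1)
    (hQ0 : 1 ≤ Q) (hQR : Q ≤ R) (hQRp : Q + R ≤ p)
    (hQ : (p : ℤ) ∣ q * Q - s) (hR : (p : ℤ) ∣ r * R - s) (k : ℕ) :
    -(min ((p : ℤ) + 2 * Q - R) R) ≤ (Polynomial.cyclotomic (p * q * r) ℤ).coeff k ∧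
      (Polynomial.cyclotomic (p * q * r) ℤ).coeff k ≤ min (2 * Q + R) ((p : ℤ) - R) := by
  have hp' : (1 : ℤ) < p := by exact_mod_cast hp.one_lt
  have hq' : (1 : ℤ) < q := by exact_mod_cast hq.one_lt
  have hr' : (1 : ℤ) < r := by exact_mod_cast hr.one_lt
  have h1 : IsCoprime (p : ℤ) q := Nat.isCoprime_iff_coprime.2 ((Nat.coprime_primes hp hq).2 hpq)
  have h2 : IsCoprime (p : ℤ) r := Nat.isCoprime_iff_coprime.2 ((Nat.coprime_primes hp hr).2 hpr)
  have h3 : IsCoprime (q : ℤ) r := Nat.isCoprime_iff_coprime.2 ((Nat.coprime_primes hq hr).2 hqr)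
  have hpq0 : (0 : ℤ) < p * q := by positivity
  have hpr0 : (0 : ℤ) < p * r := by positivity
  have hqr0 : (0 : ℤ) < q * r := by positivity
  have hP0 : (0 : ℤ) < p * q * r := by positivity
  by_cases hk : k < p * q * r
  swap
  · have : (Polynomial.cyclotomic (p * q * r) ℤ).coeff k = 0 := by
      apply Polynomial.coeff_eq_zero_of_natDegree_lt
      rw [Polynomial.natDegree_cyclotomic]
      refine lt_of_lt_of_le (Nat.totient_lt _ ?_) (not_lt.1 hk)
      have := Nat.mul_le_mul (Nat.mul_le_mul hp.two_le hq.two_le) hr.two_le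
      omega
    rw [this]
    constructor
    · rw [neg_nonpos]; apply le_min <;> omega
    · apply le_min <;> omega
  have hdata : ∀ q : ℕ, (1 : ℤ) < q → ∀ Q : ℤ, 1 ≤ Q → Q < p → (p : ℤ) ∣ q * Q - s →
      ∃ π : ℤ, 0 ≤ π ∧ π ≤ q ∧ q * Q + p * π = p * q + s := by
    intro q hq' Q hQ0 hQp ⟨t, ht⟩
    refine ⟨q - t, ?_, ?_, by linear_combination ht⟩
    · by_contra hc
      have : (p : ℤ) * (q + 1) ≤ p * t := by gcongr; omega
      have : (q : ℤ) * Q ≤ q * p := by gcongr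
      rcases hs with rfl | rfl <;> nlinarith
    · by_contra hc
      have : (p : ℤ) * t ≤ p * (-1) := by gcongr; omega
      have : (q : ℤ) * 1 ≤ q * Q := by gcongr
      rcases hs with rfl | rfl <;> nlinarith
  obtain ⟨π, hπ0, hπ, hQπ⟩ := hdata q hq' Q hQ0 (by omega) hQ
  obtain ⟨ρ, hρ0, hρ, hRρ⟩ := hdata r hr' R (by omega) (by omega) hR
  obtain ⟨N, hN⟩ : ∃ N : ℤ, N = if s = 1 then (k : ℤ) else k - q - r := ⟨_, rfl⟩
  choose a b c m hrep using fun i : ℕ =>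
    bz_rep_exists (by omega : (0 : ℤ) < p) (by omega : (0 : ℤ) < q) (by omega : (0 : ℤ) < r)
      h1 h2 h3 (N - i)
  have hk' : (k : ℤ) < p * q * r := by exact_mod_cast hk
  have hpt := fun (i : ℕ) (hi : i < p) => bz_point p q r hp.one_lt hq.one_lt hr.one_lt h1 h2 h3
    hQ0 hQR hQRp hπ0 hπ hρ0 hρ hQπ hRρ (hrep i) (by
      intro y hy
      rcases hs with rfl | rfl
      · simp only [if_true] at hN
        omega
      · rw [if_neg (by norm_num)] at hN
        omega)
  have hsum : (Polynomial.cyclotomic (p * q * r) ℤ).coeff k = ∑ i ∈ Finset.range p,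
      (bzChi p q r (N - i) - bzChi p q r (N - i - s * q) - bzChi p q r (N - i - s * r)
        + bzChi p q r (N - i - s * q - s * r)) := by
    rw [bz_coeff_formula p q r hp hq hr hpq hpr hqr k hk]
    refine Finset.sum_congr rfl fun i _ => ?_
    rcases hs with rfl | rfl
    · simp only [if_true] at hN
      rw [hN]; simp only [one_mul]
    · rw [if_neg (by norm_num)] at hN
      rw [hN, show (k : ℤ) - q - r - i - -1 * q - -1 * r = k - i by ring,
        show (k : ℤ) - q - r - i - -1 * q = k - i - r by ring,
        show (k : ℤ) - q - r - i - -1 * r = k - i - q by ring,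
        show (k : ℤ) - q - r - i = k - i - q - r by ring]
      ring
  rw [hsum]
  generalize he : (fun i : ℕ => bzChi p q r (N - i) - bzChi p q r (N - i - s * q)
    - bzChi p q r (N - i - s * r) + bzChi p q r (N - i - s * q - s * r)) = e
  have hpt' : ∀ i < p,
      (e i ≤ 0 ∨ e i = 1 ∧ (a i < Q ∨ (Q + R ≤ a i ∧ π ≤ b i ∧ ρ ≤ c i ∧ m i = -2))) ∧
      (0 ≤ e i ∨ e i = -1 ∧ (R ≤ a i ∧ a i < Q + R ∨
        (Q ≤ a i ∧ a i < R ∧ π ≤ b i ∧ c i < ρ ∧ m i = -1))) := by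
    intro i hi
    obtain ⟨e', h', h''⟩ := hpt i hi
    rw [← he]
    simp only [h']
    exact h''
  have hinj : ∀ i < p, ∀ j < p, a i = a j → i = j := by
    intro i hi j hj hij
    have e1 := (hrep i).2.2.2
    have e2 := (hrep j).2.2.2
    have hd : (p : ℤ) ∣ (i : ℤ) - j := by
      refine ⟨(b j - b i) * r + (c j - c i) * q + (m j - m i) * (q * r), ?_⟩
      rw [hij] at e1
      linear_combination e2 - e1
    have := Int.eq_zero_of_abs_lt_dvd hd (by rw [abs_lt]; omega)
    omega
  have hneg : -∑ i ∈ Finset.range p, e i = ∑ i ∈ Finset.range p, -e i := by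
    rw [Finset.sum_neg_distrib]
  clear he hpt hsum
  have cardb : ∀ u v w z : ℤ, u ≤ v → w ≤ z →
      (((Finset.Ico u v ∪ Finset.Ico w z).card : ℕ) : ℤ) ≤ (v - u) + (z - w) := by
    intro u v w z h h'
    have := Finset.card_union_le (Finset.Ico u v) (Finset.Ico w z)
    rw [Int.card_Ico, Int.card_Ico] at this
    omega
  have ha := fun i => (hrep i).1
  have hb := fun i => (hrep i).2.1
  have hc := fun i => (hrep i).2.2.1
  have hx := fun i => (hrep i).2.2.2
  have U1 : ∑ i ∈ Finset.range p, e i ≤ (p : ℤ) - R := by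
    refine (bz_count p e a (Finset.Ico 0 Q ∪ Finset.Ico (Q + R) p) hinj ?_).trans
      ((cardb _ _ _ _ (by omega) (by omega)).trans (by omega))
    intro i hi
    have := hpt' i hi
    have := ha i
    simp only [Finset.mem_union, Finset.mem_Ico]
    omega
  have L1 : -∑ i ∈ Finset.range p, e i ≤ R := by
    rw [hneg]
    refine (bz_count p (fun i => -e i) a (Finset.Ico Q R ∪ Finset.Ico R (Q + R)) hinj ?_).trans
      ((cardb _ _ _ _ (by omega) (by omega)).trans (by omega))
    intro i hi
    have := hpt' i hi
    have := ha i
    simp only [Finset.mem_union, Finset.mem_Ico]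
    omega
  have hsq : s * q ≤ q ∧ -q ≤ s * q := by rcases hs with rfl | rfl <;> omega
  have hsr : s * r ≤ r ∧ -r ≤ s * r := by rcases hs with rfl | rfl <;> omega
  have P1 : (1 : ℤ) * (p - 1) < r * (p - 1) := by
    apply mul_lt_mul_of_pos_right <;> omega
  have P2 : (1 : ℤ) * (p - 1) < q * (p - 1) := by
    apply mul_lt_mul_of_pos_right <;> omega
  have Bup : ∀ i, b i * (p * r) ≤ p * q * r - p * r := fun i => by
    have : b i * ((p : ℤ) * r) ≤ (q - 1) * (p * r) := by gcongr; have := hb i; omega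
    linarith
  have Blo : ∀ i, π ≤ b i → p * q * r + s * r - q * r * Q ≤ b i * (p * r) := fun i h => by
    have : π * ((p : ℤ) * r) ≤ b i * (p * r) := by gcongr
    have e : π * ((p : ℤ) * r) = p * q * r + s * r - q * r * Q := by
      linear_combination r * hQπ
    linarith
  have Cup : ∀ i, c i * (p * q) ≤ p * q * r - p * q := fun i => by
    have : c i * ((p : ℤ) * q) ≤ (r - 1) * (p * q) := by gcongr; have := hc i; omega
    linarith
  have eρ : ρ * ((p : ℤ) * q) = p * q * r + s * q - q * r * R := by
      linear_combination q * hRρ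
  have Clo : ∀ i, ρ ≤ c i → p * q * r + s * q - q * r * R ≤ c i * (p * q) := fun i h => by
    have : ρ * ((p : ℤ) * q) ≤ c i * (p * q) := by gcongr
    linarith
  have Cup2 : ∀ i, c i < ρ → c i * (p * q) ≤ p * q * r + s * q - q * r * R - p * q := fun i h => by
    have : c i * ((p : ℤ) * q) ≤ (ρ - 1) * (p * q) := by gcongr; omega
    linarith
  have C0 : ∀ i, 0 ≤ c i * ((p : ℤ) * q) := fun i => mul_nonneg (hc i).1 hpq0.le
  have U2 : ∑ i ∈ Finset.range p, e i ≤ 2 * Q + R := by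
    obtain ⟨L, hL⟩ := bz_interval (q * r) (N - p + 1 + p * r + p * q)
      (N - s * r - s * q + q * r * (Q + R)) (Q + R) hqr0 (by linarith)
    refine (bz_count p e a (Finset.Ico 0 Q ∪ Finset.Ico L (L + (Q + R))) hinj ?_).trans
      ((cardb _ _ _ _ (by omega) (by omega)).trans (by omega))
    intro i hi
    rcases (hpt' i hi).1 with h | ⟨h, h' | ⟨-, hb', hc', hm⟩⟩
    · exact Or.inl h
    · refine Or.inr ⟨h, Finset.mem_union_left _ (Finset.mem_Ico.2 ⟨(ha i).1, h'⟩)⟩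
    · refine Or.inr ⟨h, Finset.mem_union_right _ (hL _ ?_ ?_)⟩
      · have e1 := hx i
        rw [hm] at e1
        have := Bup i
        have := Cup i
        have : (i : ℤ) + 1 ≤ p := by omega
        linarith
      · have e1 := hx i
        rw [hm] at e1
        have := Blo i hb'
        have := Clo i hc'
        have : (0 : ℤ) ≤ i := by omega
        linarith
  have L2 : -∑ i ∈ Finset.range p, e i ≤ p + 2 * Q - R := by
    rw [hneg]
    obtain ⟨L, hL⟩ := bz_interval (q * r) (N - p + 1 + p * r + p * q - p * q * r - s * q + q * r * R)
      (N - s * r + q * r * Q) (p + Q - R) hqr0 (by linarith)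
    refine (bz_count p (fun i => -e i) a (Finset.Ico R (Q + R) ∪ Finset.Ico L (L + (p + Q - R)))
      hinj ?_).trans ((cardb _ _ _ _ (by omega) (by omega)).trans (by omega))
    intro i hi
    rcases (hpt' i hi).2 with h | ⟨h, h' | ⟨-, -, hb', hc', hm⟩⟩
    · exact Or.inl (by omega)
    · refine Or.inr ⟨by omega, Finset.mem_union_left _ (Finset.mem_Ico.2 h')⟩
    · refine Or.inr ⟨by omega, Finset.mem_union_right _ (hL _ ?_ ?_)⟩
      · have e1 := hx i
        rw [hm] at e1
        have := Bup i
        have := Cup2 i hc'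
        have : (i : ℤ) + 1 ≤ p := by omega
        linarith
      · have e1 := hx i
        rw [hm] at e1
        have := Blo i hb'
        have := C0 i
        have : (0 : ℤ) ≤ i := by omega
        linarith
  constructor
  · rw [neg_le]
    exact le_min L2 L1
  · exact le_min U2 U1

theorem bz_d_eq (p q r Q d R s : ℤ) (hs : s = 1 ∨ s = -1) (hR0 : 1 ≤ R) (hR : R < p)
    (hd0 : 1 ≤ d) (hd : d < p) (hq : p ∣ q * Q - s) (hr : p ∣ r * R - s)
    (h : p ∣ Q * d * q * r - 1) : d = R := by
  have hss : s * s = 1 := by rcases hs with rfl | rfl <;> norm_num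
  obtain ⟨t, ht⟩ := hq
  obtain ⟨u, hu⟩ := hr
  obtain ⟨v, hv⟩ := h
  have hdvd : p ∣ d - R := by
    refine ⟨R * v - d * (t * s + u * s + p * t * u), ?_⟩
    linear_combination R * hv - (d * r * R) * ht - (d * (s + p * t)) * hu - d * hss
  have := Int.eq_zero_of_abs_lt_dvd hdvd (by rw [abs_lt]; omega)
  omega

theorem bzdega_bound (p q r : ℕ) (hp : p.Prime) (hq : q.Prime) (hr : r.Prime)
    (hp3 : 3 ≤ p) (hpq : p < q) (hqr : q < r)
    (qs rs : ℕ)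
    (hqs1 : 1 ≤ qs) (hqs2 : qs ≤ p - 1) (hqsinv : q * qs ≡ 1 [MOD p])
    (hrs1 : 1 ≤ rs) (hrs2 : rs ≤ p - 1) (hrsinv : r * rs ≡ 1 [MOD p])
    (a : ℕ) (ha : a = min (min qs rs) (min (p - qs) (p - rs)))
    (d : ℕ) (hd1 : 1 ≤ d) (hd2 : d ≤ p - 1) (hdinv : a * d * q * r ≡ 1 [MOD p]) :
    ∀ k : ℕ,
      -(min ((p : ℤ) + 2 * (a : ℤ) - (d : ℤ)) (d : ℤ)) ≤
          (Polynomial.cyclotomic (p * q * r) ℤ).coeff k ∧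
        (Polynomial.cyclotomic (p * q * r) ℤ).coeff k ≤
          min (2 * (a : ℤ) + (d : ℤ)) ((p : ℤ) - (d : ℤ)) := by

  intro k
  have hpr : p < r := hpq.trans hqr
  have cq : (p : ℤ) ∣ q * qs - 1 := by
    have := (Nat.modEq_iff_dvd.1 hqsinv.symm)
    push_cast at this; exact this
  have cr : (p : ℤ) ∣ r * rs - 1 := by
    have := (Nat.modEq_iff_dvd.1 hrsinv.symm)
    push_cast at this; exact this
  have cd : (p : ℤ) ∣ a * d * q * r - 1 := by
    have := (Nat.modEq_iff_dvd.1 hdinv.symm)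
    push_cast at this; exact this
  have cd' : (p : ℤ) ∣ a * d * r * q - 1 := by
    rw [show (a : ℤ) * d * r * q = a * d * q * r by ring]; exact cd
  have cq' : (p : ℤ) ∣ q * ((p : ℤ) - qs) - (-1) := by
    obtain ⟨t, ht⟩ := cq
    exact ⟨q - t, by linear_combination -ht⟩
  have cr' : (p : ℤ) ∣ r * ((p : ℤ) - rs) - (-1) := by
    obtain ⟨t, ht⟩ := cr
    exact ⟨r - t, by linear_combination -ht⟩
  have hcases : a = qs ∨ a = rs ∨ (a : ℤ) = p - qs ∨ (a : ℤ) = p - rs := by omega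
  have hle : (a : ℤ) ≤ qs ∧ (a : ℤ) ≤ rs ∧ (a : ℤ) ≤ p - qs ∧ (a : ℤ) ≤ p - rs := by omega
  have ha1 : 1 ≤ a := by omega
  have hswap : p * q * r = p * r * q := by ring
  rcases hcases with h | h | h | h
  · have ed : (d : ℤ) = rs := bz_d_eq p q r a d rs 1 (Or.inl rfl) (by omega) (by omega) (by omega)
      (by omega) (by rw [h]; exact cq) cr cd
    exact bz_core p q r hp hq hr hpq.ne hpr.ne hqr.ne 1 a d (Or.inl rfl) (by omega) (by omega)
      (by omega) (by rw [h]; exact cq) (by rw [ed]; exact cr) k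
  · have ed : (d : ℤ) = qs := bz_d_eq p r q a d qs 1 (Or.inl rfl) (by omega) (by omega) (by omega)
      (by omega) (by rw [h]; exact cr) cq cd'
    rw [hswap]
    exact bz_core p r q hp hr hq hpr.ne hpq.ne hqr.ne' 1 a d (Or.inl rfl) (by omega) (by omega)
      (by omega) (by rw [h]; exact cr) (by rw [ed]; exact cq) k
  · have ed : (d : ℤ) = p - rs := bz_d_eq p q r a d (p - rs) (-1) (Or.inr rfl) (by omega)
      (by omega) (by omega) (by omega) (by rw [h]; exact cq') cr' cd
    exact bz_core p q r hp hq hr hpq.ne hpr.ne hqr.ne (-1) a d (Or.inr rfl) (by omega) (by omega)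
      (by omega) (by rw [h]; exact cq') (by rw [ed]; exact cr') k
  · have ed : (d : ℤ) = p - qs := bz_d_eq p r q a d (p - qs) (-1) (Or.inr rfl) (by omega)
      (by omega) (by omega) (by omega) (by rw [h]; exact cr') cq' cd'
    rw [hswap]
    exact bz_core p r q hp hr hq hpr.ne hpq.ne hqr.ne' (-1) a d (Or.inr rfl) (by omega) (by omega)
      (by omega) (by rw [h]; exact cr') (by rw [ed]; exact cq') k
end

section
/- Let 3 ≤ p < q < r be odd primes and n = pqr. Then h(Ψ_n) = p - 1 if and only if q ≡ r ≡ ±1 (mod p) (both congruent to 1 or both to -1 mod p) and r < ((p-1)/(p-2))·(q-1); in all remaining cases h(Ψ_n) < p - 1. -/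
open Polynomial

/-- The height of a polynomial over `ℤ`: the maximum of the absolute values of
its coefficients. -/
noncomputable def polyHeight (f : Polynomial ℤ) : ℕ :=
  f.support.sup fun k => (f.coeff k).natAbs

/-- The `n`-th inverse cyclotomic polynomial `Ψ_n = (x^n - 1)/Φ_n`. -/
noncomputable def invCyclotomic (n : ℕ) : Polynomial ℤ :=
  (X ^ n - 1) /ₘ Polynomial.cyclotomic n ℤ


theorem phi_mul (p q : ℕ) (hp : p.Prime) (hq : q.Prime) (hpq : p < q) :
    cyclotomic (p * q) ℤ * ((X ^ q - 1) * ∑ j ∈ Finset.range p, X ^ j) = X ^ (p * q) - 1 := by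
  have := Fact.mk hp
  have hd : ¬ q ∣ p := fun h => absurd (Nat.le_of_dvd hp.pos h) (by omega)
  have h1 := cyclotomic_expand_eq_cyclotomic_mul hq hd ℤ
  rw [cyclotomic_prime ℤ p] at h1
  have h2 : (∑ j ∈ Finset.range p, (X : ℤ[X]) ^ j) * (X - 1) = X ^ p - 1 := geom_sum_mul X p
  have h3 := congrArg (expand ℤ q) h2
  rw [map_mul, h1] at h3
  simp only [map_sub, map_pow, expand_X, map_one] at h3
  rw [← pow_mul, mul_comm q p] at h3
  rw [← h3]; ring

theorem phi_identity (p q : ℕ) (hp : p.Prime) (hq : q.Prime) (hpq : p < q) :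
    cyclotomic (p * q) ℤ * ((X ^ q - 1) * (X ^ p - 1)) = (X ^ (p * q) - 1) * (X - 1) := by
  have h2 : (∑ j ∈ Finset.range p, (X : ℤ[X]) ^ j) * (X - 1) = X ^ p - 1 := geom_sum_mul X p
  rw [← phi_mul p q hp hq hpq, ← h2]; ring

/-- sign weights -/
def sgnW (p q j : ℕ) : ℤ := if j < p then 1 else if q ≤ j ∧ j < p + q then -1 else 0

theorem psi_poly (p q r : ℕ) (hp : p.Prime) (hq : q.Prime) (hr : r.Prime)
    (hpq : p < q) (hqr : q < r) :
    (X ^ (p * q * r) - 1) /ₘ Polynomial.cyclotomic (p * q * r) ℤ =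
      cyclotomic (p * q) ℤ * ((X ^ (q * r) - 1) * ∑ j ∈ Finset.range p, X ^ (j * r)) := by
  have hd : ¬ r ∣ p * q := by
    intro h
    rcases (Nat.Prime.dvd_mul hr).1 h with h | h
    · exact absurd (Nat.le_of_dvd hp.pos h) (by omega)
    · exact absurd (Nat.le_of_dvd hq.pos h) (by omega)
  have h1 := cyclotomic_expand_eq_cyclotomic_mul hr hd ℤ
  have h3 := congrArg (expand ℤ r) (phi_mul p q hp hq hpq)
  rw [map_mul, h1] at h3
  simp only [map_sub, map_pow, expand_X, map_one, map_mul, map_sum] at h3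
  simp only [← pow_mul] at h3
  rw [← mul_comm (p*q) r, ← mul_comm q r] at h3
  simp only [mul_comm r] at h3
  have h4 := div_modByMonic_unique (f := X ^ (p * q * r) - 1) (g := cyclotomic (p * q * r) ℤ)
    (cyclotomic (p * q) ℤ * ((X ^ (q * r) - 1) * ∑ j ∈ Finset.range p, X ^ (j * r))) 0
    (cyclotomic.monic _ _) ⟨by rw [← h3]; ring, by
      rw [degree_zero]; exact bot_lt_iff_ne_bot.2 (by
        rw [Ne, degree_eq_bot]; exact cyclotomic_ne_zero _ _)⟩
  exact h4.1

theorem psi_poly2 (p q r : ℕ) (hpq : p < q) :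
    ((X : ℤ[X]) ^ (q * r) - 1) * ∑ j ∈ Finset.range p, X ^ (j * r) =
     - ∑ j ∈ Finset.range (q + p), C (sgnW p q j) * X ^ (j * r) := by
  rw [Finset.sum_range_add]
  obtain ⟨d, rfl⟩ := Nat.exists_eq_add_of_lt hpq
  have e1 : ∑ j ∈ Finset.range (p + d + 1), C (sgnW p (p+d+1) j) * (X:ℤ[X]) ^ (j * r) =
     ∑ j ∈ Finset.range p, X ^ (j * r) := by
    rw [add_assoc, Finset.sum_range_add]
    rw [Finset.sum_eq_zero (s := Finset.range (d+1)), add_zero]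
    · refine Finset.sum_congr rfl fun j hj => ?_
      rw [Finset.mem_range] at hj
      simp [sgnW, hj]
    · intro j hj
      rw [Finset.mem_range] at hj
      rw [sgnW, if_neg (by omega), if_neg (by omega)]; simp
  have e2 : ∑ j ∈ Finset.range p, C (sgnW p (p+d+1) (p+d+1+j)) * (X:ℤ[X]) ^ ((p+d+1+j) * r) =
     - (X ^ ((p+d+1) * r) * ∑ j ∈ Finset.range p, X ^ (j * r)) := by
    rw [Finset.mul_sum, ← Finset.sum_neg_distrib]
    refine Finset.sum_congr rfl fun j hj => ?_
    rw [Finset.mem_range] at hj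
    rw [sgnW, if_neg (by omega), if_pos (by omega), add_mul (p+d+1), pow_add]; simp
  rw [e1, e2]; ring

/-- extended coefficients -/
noncomputable def gco (p q r k j : ℕ) : ℤ :=
  sgnW p q j * (if j * r ≤ k then (cyclotomic (p * q) ℤ).coeff (k - j * r) else 0)

theorem psi_coeff (p q r : ℕ) (hp : p.Prime) (hq : q.Prime) (hr : r.Prime)
    (hpq : p < q) (hqr : q < r) (k : ℕ) :
    ((X ^ (p * q * r) - 1) /ₘ Polynomial.cyclotomic (p * q * r) ℤ).coeff k =
     - ∑ j ∈ Finset.range (q + p), gco p q r k j := by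
  rw [psi_poly p q r hp hq hr hpq hqr, psi_poly2 p q r hpq, mul_neg, coeff_neg, Finset.mul_sum,
    finsetSum_coeff]
  congr 1
  refine Finset.sum_congr rfl fun j _ => ?_
  rw [mul_left_comm, coeff_C_mul, coeff_mul_X_pow', gco]

/-- explicit formula -/
theorem phi_formula (p q μ l : ℕ) (hp : p.Prime) (hq : q.Prime) (hpq : p < q)
    (hμ : μ ≤ q) (hl : l ≤ p) (h : μ * p + l * q = p * q + 1) :
    cyclotomic (p * q) ℤ * X ^ (p * q) =
      X ^ (p*q) * ((∑ i ∈ Finset.range μ, X ^ (i * p)) * ∑ j ∈ Finset.range l, X ^ (j * q)) -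
      ((∑ i ∈ Finset.Ico μ q, X ^ (i * p)) * ∑ j ∈ Finset.Ico l p, X ^ (j * q)) := by
  have hA : (∑ i ∈ Finset.range μ, (X:ℤ[X]) ^ (i * p)) * (X ^ p - 1) = X ^ (μ * p) - 1 := by
    have := geom_sum_mul ((X:ℤ[X])^p) μ
    simp only [← pow_mul, mul_comm p] at this; exact this
  have hB : (∑ i ∈ Finset.range l, (X:ℤ[X]) ^ (i * q)) * (X ^ q - 1) = X ^ (l * q) - 1 := by
    have := geom_sum_mul ((X:ℤ[X])^q) l
    simp only [← pow_mul, mul_comm q] at this; exact this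
  have hC : (∑ i ∈ Finset.Ico μ q, (X:ℤ[X]) ^ (i * p)) * (X ^ p - 1) = X ^ (p * q) - X ^ (μ * p) := by
    have := geom_sum_Ico_mul ((X:ℤ[X])^p) hμ
    simp only [← pow_mul, mul_comm p] at this; rw [mul_comm p]; exact this
  have hD : (∑ i ∈ Finset.Ico l p, (X:ℤ[X]) ^ (i * q)) * (X ^ q - 1) = X ^ (p * q) - X ^ (l * q) := by
    have := geom_sum_Ico_mul ((X:ℤ[X])^q) hl
    simp only [← pow_mul, mul_comm q] at this; exact this
  have hne : ((X:ℤ[X]) ^ q - 1) * (X ^ p - 1) ≠ 0 :=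
    mul_ne_zero (X_pow_sub_C_ne_zero hq.pos 1) (X_pow_sub_C_ne_zero hp.pos 1)
  apply mul_right_cancel₀ hne
  have hI := phi_identity p q hp hq hpq
  have hU : (X:ℤ[X]) ^ (μ * p) * X ^ (l * q) = X ^ (p * q) * X := by
    rw [← pow_add, h, pow_succ]
  generalize (∑ i ∈ Finset.range μ, (X:ℤ[X]) ^ (i * p)) = A at *
  generalize (∑ i ∈ Finset.range l, (X:ℤ[X]) ^ (i * q)) = B at *
  generalize (∑ i ∈ Finset.Ico μ q, (X:ℤ[X]) ^ (i * p)) = CC at *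
  generalize (∑ i ∈ Finset.Ico l p, (X:ℤ[X]) ^ (i * q)) = D at *
  calc cyclotomic (p * q) ℤ * X ^ (p * q) * ((X ^ q - 1) * (X ^ p - 1))
      = (cyclotomic (p * q) ℤ * ((X ^ q - 1) * (X ^ p - 1))) * X ^ (p*q) := by ring
    _ = ((X ^ (p * q) - 1) * (X - 1)) * X ^ (p*q) := by rw [hI]
    _ = X ^ (p*q) * ((X ^ (μ * p) - 1) * (X ^ (l * q) - 1)) -
         (X ^ (p * q) - X ^ (μ * p)) * (X ^ (p * q) - X ^ (l * q)) := by
        linear_combination (1 - X ^ (p*q)) * hU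
    _ = _ := by rw [← hA, ← hB, ← hC, ← hD]; ring

theorem phi_coeff (p q μ l : ℕ) (hp : p.Prime) (hq : q.Prime) (hpq : p < q)
    (hμ : μ ≤ q) (hl : l ≤ p) (h : μ * p + l * q = p * q + 1) (k : ℕ) :
    (cyclotomic (p * q) ℤ).coeff k =
      (∑ t ∈ Finset.range μ ×ˢ Finset.range l, if k = t.1 * p + t.2 * q then 1 else 0) -
      (∑ t ∈ Finset.Ico μ q ×ˢ Finset.Ico l p, if k + p * q = t.1 * p + t.2 * q then 1 else 0) := by
  have e := congrArg (fun f => coeff f (k + p * q)) (phi_formula p q μ l hp hq hpq hμ hl h)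
  simp only [coeff_mul_X_pow, coeff_sub, coeff_X_pow_mul] at e
  rw [e, Finset.sum_mul_sum, Finset.sum_mul_sum, ← Finset.sum_product', ← Finset.sum_product',
    finsetSum_coeff, finsetSum_coeff]
  simp only [← pow_add, coeff_X_pow]

theorem rep_unique (p q : ℕ) (hp : p.Prime) (hq : q.Prime) (hpq : p < q) (x y x' y' k : ℕ)
    (hx : x < q) (hx' : x' < q) (hy : y < p) (hy' : y' < p)
    (h : x * p + y * q = x' * p + y' * q + k * (p * q)) : x = x' ∧ y = y' := by
  have hc : Nat.Coprime p q := (Nat.coprime_primes hp hq).2 hpq.ne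
  have h1 : y ≡ y' [MOD p] := by
    apply Nat.ModEq.cancel_right_of_coprime (c := q) hc
    have := congrArg (· % p) h
    simpa [Nat.ModEq, Nat.add_mod, Nat.mul_mod] using this
  have h2 : x ≡ x' [MOD q] := by
    apply Nat.ModEq.cancel_right_of_coprime (c := p) hc.symm
    have := congrArg (· % q) h
    simpa [Nat.ModEq, Nat.add_mod, Nat.mul_mod] using this
  exact ⟨Nat.ModEq.eq_of_lt_of_lt h2 hx hx', Nat.ModEq.eq_of_lt_of_lt h1 hy hy'⟩

theorem sum_ite_le_one {S : Finset (ℕ × ℕ)} {P : ℕ × ℕ → Prop} [DecidablePred P]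
    (h : ∀ a ∈ S, ∀ b ∈ S, P a → P b → a = b) :
    (∑ t ∈ S, if P t then (1:ℤ) else 0) = if ∃ t ∈ S, P t then 1 else 0 := by
  split_ifs with h0
  · obtain ⟨t, ht, hP⟩ := h0
    rw [Finset.sum_eq_single_of_mem t ht, if_pos hP]
    intro b hb hne
    rw [if_neg]; intro hPb; exact hne (h _ hb _ ht hPb hP)
  · refine Finset.sum_eq_zero fun t ht => if_neg fun hP => h0 ⟨t, ht, hP⟩

theorem ite_pm (A B : Prop) [Decidable A] [Decidable B] (hn : ¬ (A ∧ B)) :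
    |(if A then (1:ℤ) else 0) - if B then 1 else 0| ≤ 1 ∧
    ((if A then (1:ℤ) else 0) - (if B then 1 else 0) = 1 ↔ A) ∧
    ((if A then (1:ℤ) else 0) - (if B then 1 else 0) = -1 ↔ B) := by
  by_cases hA : A <;> by_cases hB : B <;> simp_all

theorem phi_coeff_pm (p q μ l : ℕ) (hp : p.Prime) (hq : q.Prime) (hpq : p < q)
    (hμ : μ ≤ q) (hl : l ≤ p) (h : μ * p + l * q = p * q + 1) (k : ℕ) :
    |(cyclotomic (p * q) ℤ).coeff k| ≤ 1 ∧
    ((cyclotomic (p * q) ℤ).coeff k = 1 ↔ ∃ x y, x < μ ∧ y < l ∧ k = x * p + y * q) ∧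
    ((cyclotomic (p * q) ℤ).coeff k = -1 ↔
      ∃ x y, μ ≤ x ∧ x < q ∧ l ≤ y ∧ y < p ∧ k + p * q = x * p + y * q) := by
  rw [phi_coeff p q μ l hp hq hpq hμ hl h k, sum_ite_le_one, sum_ite_le_one]
  · have ha : (∃ t ∈ Finset.range μ ×ˢ Finset.range l, k = t.1 * p + t.2 * q) ↔
        ∃ x y, x < μ ∧ y < l ∧ k = x * p + y * q := by
      simp [and_assoc]
    have hb : (∃ t ∈ Finset.Ico μ q ×ˢ Finset.Ico l p, k + p * q = t.1 * p + t.2 * q) ↔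
        ∃ x y, μ ≤ x ∧ x < q ∧ l ≤ y ∧ y < p ∧ k + p * q = x * p + y * q := by
      simp [and_assoc]
    have hn : ¬ ((∃ x y, x < μ ∧ y < l ∧ k = x * p + y * q) ∧
        ∃ x y, μ ≤ x ∧ x < q ∧ l ≤ y ∧ y < p ∧ k + p * q = x * p + y * q) := by
      rintro ⟨⟨x, y, hx, hy, e⟩, x', y', hx1, hx2, hy1, hy2, e'⟩
      have := rep_unique p q hp hq hpq x' y' x y 1 (by omega) (by omega) (by omega) (by omega)
        (by omega)
      omega
    rw [← ha, ← hb] at hn ⊢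
    exact ite_pm _ _ hn
  · rintro ⟨x, y⟩ ha ⟨x', y'⟩ hb e1 e2
    simp only [Finset.mem_product, Finset.mem_Ico] at ha hb e1 e2
    have := rep_unique p q hp hq hpq x y x' y' 0 (by omega) (by omega) (by omega) (by omega)
      (by omega)
    simp [this]
  · rintro ⟨x, y⟩ ha ⟨x', y'⟩ hb e1 e2
    simp only [Finset.mem_product, Finset.mem_range] at ha hb e1 e2
    have := rep_unique p q hp hq hpq x y x' y' 0 (by omega) (by omega) (by omega) (by omega)
      (by omega)
    simp [this]

theorem exists_mu (p q : ℕ) (hp : p.Prime) (hq : q.Prime) (hpq : p < q) :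
    ∃ μ l, 1 ≤ μ ∧ μ ≤ q ∧ 1 ≤ l ∧ l < p ∧ μ * p + l * q = p * q + 1 := by
  have hc : Nat.Coprime q p := (Nat.coprime_primes hq hp).2 hpq.ne'
  obtain ⟨l, hlp, hl⟩ := Nat.exists_mul_mod_eq_one_of_coprime hc hp.one_lt
  have hl0 : 1 ≤ l := by
    rcases Nat.eq_zero_or_pos l with h | h
    · subst h; simp at hl
    · exact h
  have hdm := Nat.div_add_mod (q * l) p
  rw [hl] at hdm
  have ht : q * l / p < q := by
    apply Nat.div_lt_of_lt_mul
    rw [mul_comm]; exact Nat.mul_lt_mul_of_pos_right hlp hq.pos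
  refine ⟨q - q * l / p, l, by omega, Nat.sub_le _ _, hl0, hlp, ?_⟩
  obtain ⟨d, hd⟩ := Nat.exists_eq_add_of_lt ht
  have : q - q * l / p = d + 1 := by omega
  rw [this]
  generalize q * l / p = t at *
  nlinarith

theorem gco_abs_le (p q r k j : ℕ) (hp : p.Prime) (hq : q.Prime) (hpq : p < q) :
    |gco p q r k j| ≤ 1 := by
  obtain ⟨μ, l, _, hμ, _, hl, h⟩ := exists_mu p q hp hq hpq
  have hb := (phi_coeff_pm p q μ l hp hq hpq hμ hl.le h (k - j * r)).1
  rw [gco, abs_mul]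
  have h1 : |sgnW p q j| ≤ 1 := by
    unfold sgnW; split_ifs <;> simp
  have h2 : |if j * r ≤ k then (cyclotomic (p * q) ℤ).coeff (k - j * r) else 0| ≤ 1 := by
    split_ifs
    · exact hb
    · simp
  exact mul_le_one₀ h1 (abs_nonneg _) h2

theorem phi_deg (p q k : ℕ) (hp : p.Prime) (hq : q.Prime) (hpq : p < q)
    (h : (cyclotomic (p * q) ℤ).coeff k ≠ 0) : k ≤ (p - 1) * (q - 1) := by
  have := le_natDegree_of_ne_zero h
  rwa [natDegree_cyclotomic, Nat.totient_mul ((Nat.coprime_primes hp hq).2 hpq.ne),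
    Nat.totient_prime hp, Nat.totient_prime hq] at this

theorem gco_window (p q r k j j' : ℕ) (hp : p.Prime) (hq : q.Prime) (hpq : p < q) (hqr : q < r)
    (hj : gco p q r k j ≠ 0) (hj' : gco p q r k j' ≠ 0) : j' < j + (p - 1) := by
  have h1 : k - j * r ≤ (p - 1) * (q - 1) := by
    apply phi_deg p q _ hp hq hpq
    intro h; apply hj; simp [gco, h]
  have h2 : j' * r ≤ k := by
    by_contra h; apply hj'; simp [gco, h]
  by_contra hc
  have h3 : (j + (p - 1)) * r ≤ j' * r := Nat.mul_le_mul_right r (by omega)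
  have hp1 : 0 < p - 1 := by have := hp.two_le; omega
  have h4 : (p - 1) * (q - 1) < (p - 1) * r := Nat.mul_lt_mul_of_pos_left (by omega) hp1
  rw [add_mul] at h3
  omega

theorem sum_window (p q r k : ℕ) (hp : p.Prime) (hq : q.Prime) (hpq : p < q) (hqr : q < r) :
    ∃ j0, ∑ j ∈ Finset.range (q + p), gco p q r k j =
      ∑ i ∈ Finset.range (p - 1), gco p q r k (j0 + i) := by
  have hz : ∀ j, ¬ j < q + p → gco p q r k j = 0 := by
    intro j hj
    rw [gco, sgnW, if_neg (by omega), if_neg (by omega), zero_mul]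
  by_cases hex : ∃ j, gco p q r k j ≠ 0
  · classical
    refine ⟨Nat.find hex, ?_⟩
    have h0 := Nat.find_spec hex
    have hmin : ∀ m, gco p q r k m ≠ 0 → Nat.find hex ≤ m := fun m hm => Nat.find_min' hex hm
    generalize Nat.find hex = j0 at *
    have e : ∑ i ∈ Finset.range (p - 1), gco p q r k (j0 + i) =
        ∑ j ∈ Finset.Ico j0 (j0 + (p - 1)), gco p q r k j := by
      rw [Finset.sum_Ico_eq_sum_range]; simp
    rw [e, ← Finset.sum_filter_ne_zero, ← Finset.sum_filter_ne_zero (s := Finset.Ico _ _)]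
    refine Finset.sum_congr ?_ fun _ _ => rfl
    ext j
    simp only [Finset.mem_filter, Finset.mem_range, Finset.mem_Ico]
    constructor
    · rintro ⟨_, h⟩
      exact ⟨⟨hmin j h, gco_window p q r k j0 j hp hq hpq hqr h0 h⟩, h⟩
    · rintro ⟨_, h⟩
      refine ⟨?_, h⟩
      by_contra hc; exact h (hz j hc)
  · push Not at hex
    exact ⟨0, by simp [hex]⟩

theorem psi_le (p q r k : ℕ) (hp : p.Prime) (hq : q.Prime) (hpq : p < q) (hqr : q < r) :
    |∑ j ∈ Finset.range (q + p), gco p q r k j| ≤ ((p - 1 : ℕ) : ℤ) := by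
  obtain ⟨j0, h⟩ := sum_window p q r k hp hq hpq hqr
  rw [h]
  refine (Finset.abs_sum_le_sum_abs _ _).trans ?_
  refine (Finset.sum_le_card_nsmul _ _ 1 fun i _ => gco_abs_le p q r k _ hp hq hpq).trans ?_
  simp

theorem sum_ext (n : ℕ) (f : ℕ → ℤ) (hf : ∀ i, f i ≤ 1) (h : ∑ i ∈ Finset.range n, f i = n) :
    ∀ i < n, f i = 1 := by
  have h1 : ∑ i ∈ Finset.range n, f i = ∑ i ∈ Finset.range n, 1 := by simp [h]
  intro i hi
  exact (Finset.sum_eq_sum_iff_of_le fun i _ => hf i).1 h1 i (Finset.mem_range.2 hi)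

theorem psi_eq (p q r k : ℕ) (hp : p.Prime) (hq : q.Prime) (hp3 : 3 ≤ p) (hpq : p < q) (hqr : q < r)
    (h : |∑ j ∈ Finset.range (q + p), gco p q r k j| = ((p - 1 : ℕ) : ℤ)) :
    ∃ m, (∀ i < p - 1, (cyclotomic (p * q) ℤ).coeff (m + i * r) = 1) ∨
      (∀ i < p - 1, (cyclotomic (p * q) ℤ).coeff (m + i * r) = -1) := by
  obtain ⟨j0, h0⟩ := sum_window p q r k hp hq hpq hqr
  rw [h0] at h
  have key : ∃ ε : ℤ, (ε = 1 ∨ ε = -1) ∧ ∀ i < p - 1, gco p q r k (j0 + i) = ε := by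
    rcases (abs_eq (by positivity)).1 h with h | h
    · exact ⟨1, Or.inl rfl, sum_ext _ _ (fun i => (abs_le.1 (gco_abs_le p q r k _ hp hq hpq)).2) h⟩
    · refine ⟨-1, Or.inr rfl, fun i hi => ?_⟩
      have := sum_ext (p - 1) (fun i => - gco p q r k (j0 + i))
        (fun i => by have := (abs_le.1 (gco_abs_le p q r k (j0 + i) hp hq hpq)).1; linarith)
        (by rw [Finset.sum_neg_distrib, h, neg_neg]) i hi
      linarith
  obtain ⟨ε, hε, hall⟩ := key
  have hne : ∀ i < p - 1, gco p q r k (j0 + i) ≠ 0 := by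
    intro i hi; rw [hall i hi]; rcases hε with rfl | rfl <;> norm_num
  have hs : ∀ i < p - 1, sgnW p q (j0 + i) ≠ 0 := by
    intro i hi h; apply hne i hi; rw [gco, h, zero_mul]
  have hle : (j0 + (p - 2)) * r ≤ k := by
    by_contra hc; exact hne (p - 2) (by omega) (by simp [gco, hc])
  have hco : ∀ i < p - 1, gco p q r k (j0 + i) =
      sgnW p q (j0 + i) * (cyclotomic (p * q) ℤ).coeff (k - (j0 + i) * r) := by
    intro i hi
    rw [gco, if_pos]
    exact (Nat.mul_le_mul_right r (by omega)).trans hle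
  have hside : ∃ s : ℤ, (s = 1 ∨ s = -1) ∧ ∀ i < p - 1, sgnW p q (j0 + i) = s := by
    by_cases hj : j0 + (p - 2) < p
    · exact ⟨1, Or.inl rfl, fun i hi => by rw [sgnW, if_pos (by omega)]⟩
    · have hj0 : p ≤ j0 := by
        by_contra hc
        apply hs (p - j0) (by omega)
        rw [sgnW, if_neg (by omega), if_neg (by omega)]
      refine ⟨-1, Or.inr rfl, fun i hi => ?_⟩
      have := hs i hi
      rw [sgnW, if_neg (by omega)] at this ⊢
      split_ifs at this ⊢
      · rfl
      · exact absurd rfl this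
  obtain ⟨s, hs1, hs2⟩ := hside
  have hfin : ∀ i < p - 1, s * (cyclotomic (p * q) ℤ).coeff ((k - (j0 + (p - 2)) * r) + i * r) = ε := by
    intro i hi
    have e : (k - (j0 + (p - 2)) * r) + i * r = k - (j0 + (p - 2 - i)) * r := by
      obtain ⟨d, hd⟩ := Nat.exists_eq_add_of_le hle
      have : (j0 + (p - 2)) * r = (j0 + (p - 2 - i)) * r + i * r := by
        rw [← add_mul]; congr 1; omega
      omega
    rw [e, ← hs2 (p - 2 - i) (by omega), ← hco _ (by omega), hall _ (by omega)]
  refine ⟨k - (j0 + (p - 2)) * r, ?_⟩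
  rcases hε with rfl | rfl <;> rcases hs1 with rfl | rfl
  · left; intro i hi; have := hfin i hi; linarith
  · right; intro i hi; have := hfin i hi; linarith
  · right; intro i hi; have := hfin i hi; linarith
  · left; intro i hi; have := hfin i hi; linarith

theorem psi_eq_conv (p q r m : ℕ) (ε : ℤ) (hε : |ε| = 1) (hp : p.Prime) (hq : q.Prime)
    (hp3 : 3 ≤ p) (hpq : p < q) (hqr : q < r)
    (h : ∀ i < p - 1, (cyclotomic (p * q) ℤ).coeff (m + i * r) = ε) :
    ∃ k, |∑ j ∈ Finset.range (q + p), gco p q r k j| = ((p - 1 : ℕ) : ℤ) := by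
  refine ⟨m + (p - 2) * r, ?_⟩
  have hg : ∀ i < p - 1, gco p q r (m + (p - 2) * r) i = ε := by
    intro i hi
    have h1 : i * r ≤ (p - 2) * r := Nat.mul_le_mul_right r (by omega)
    rw [gco, sgnW, if_pos (by omega), if_pos (by omega), one_mul]
    have h2 : (p - 2) * r = (p - 2 - i) * r + i * r := by
      rw [← add_mul]; congr 1; omega
    have h3 : m + (p - 2) * r - i * r = m + (p - 2 - i) * r := by omega
    rw [h3]; exact h _ (by omega)
  have hsum : ∑ j ∈ Finset.range (q + p), gco p q r (m + (p - 2) * r) j =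
      ∑ j ∈ Finset.range (p - 1), gco p q r (m + (p - 2) * r) j := by
    symm
    apply Finset.sum_subset
    · intro j; simp only [Finset.mem_range]; omega
    · intro j _ hj
      simp only [Finset.mem_range] at hj
      by_contra hne
      have h0 : gco p q r (m + (p - 2) * r) 0 ≠ 0 := by
        rw [hg 0 (by omega)]; rintro rfl; simp at hε
      have := gco_window p q r _ 0 j hp hq hpq hqr h0 hne
      omega
  rw [hsum, Finset.sum_congr rfl (fun i hi => hg i (Finset.mem_range.1 hi))]
  simp [abs_mul, hε]

/-- quotients in an arithmetic progression -/
theorem ap_div (p q r m : ℕ) (Y Z : ℕ → ℕ) (hp3 : 3 ≤ p) (hqr : q < r)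
    (h : ∀ i < p - 1, m + i * r = Y i * q + Z i) (hZ : ∀ i < p - 1, Z i < q)
    (hY : ∀ i < p - 1, Y i < p - 1) : r + Z 0 = q + Z 1 := by
  have hstep : ∀ i, i + 1 < p - 1 → Y i + 1 ≤ Y (i + 1) := by
    intro i hi
    have h1 := h i (by omega)
    have h2 := h (i + 1) hi
    have h3 := hZ (i + 1) hi
    by_contra hc
    have h4 : Y (i + 1) * q ≤ Y i * q := Nat.mul_le_mul_right q (by omega)
    rw [add_mul] at h2
    omega
  have hind : ∀ i, i + 1 < p - 1 → Y 1 + i ≤ Y (i + 1) := by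
    intro i
    induction i with
    | zero => intro _; simp
    | succ n ih => intro hi; have := ih (by omega); have := hstep (n + 1) hi; omega
  have h1 := hind (p - 3) (by omega)
  have h2 := hY (p - 3 + 1) (by omega)
  have h3 := hstep 0 (by omega)
  have h4 := h 0 (by omega)
  have h5 := h 1 (by omega)
  have e1 : Y 1 = 1 := by simp only [zero_add] at h3; omega
  have e0 : Y 0 = 0 := by simp only [zero_add] at h3; omega
  rw [e0] at h4; rw [e1] at h5; omega

theorem size_bound (p q r m : ℕ) (hp : p.Prime) (hq : q.Prime) (hr : r.Prime)
    (hp3 : 3 ≤ p) (hpq : p < q) (hqr : q < r)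
    (h : (cyclotomic (p * q) ℤ).coeff (m + (p - 2) * r) ≠ 0) :
    (p - 2) * r < (p - 1) * (q - 1) := by
  have h1 := phi_deg p q _ hp hq hpq h
  refine lt_of_le_of_ne (by omega) fun e => ?_
  have hd : r ∣ (p - 1) * (q - 1) := ⟨p - 2, by rw [← e, mul_comm]⟩
  rcases (Nat.Prime.dvd_mul hr).1 hd with h | h
  · exact absurd (Nat.le_of_dvd (by omega) h) (by omega)
  · exact absurd (Nat.le_of_dvd (by omega) h) (by omega)

/-- `p - 1` distinct residues need room -/
theorem card_room (p q r m c : ℕ) (x y : ℕ → ℕ) (S : Finset ℕ) (hp : p.Prime) (hr : r.Prime)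
    (hpr : p < r) (h : ∀ i < p - 1, m + i * r + c = x i * p + y i * q)
    (hS : ∀ i < p - 1, y i ∈ S) : p - 1 ≤ S.card := by
  have hinj : Set.InjOn y (Finset.range (p - 1) : Set ℕ) := by
    have aux : ∀ i j, i < j → j < p - 1 → y i ≠ y j := by
      intro i j hij hj e
      have h1 := h i (by omega)
      have h2 := h j hj
      rw [e] at h1
      obtain ⟨d, rfl⟩ := Nat.exists_eq_add_of_lt hij
      have h3 : (i + d + 1) * r = i * r + (d + 1) * r := by ring
      have h4 : x i * p + (d + 1) * r = x (i + d + 1) * p := by omega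
      have h5 : p ∣ (d + 1) * r :=
        (Nat.dvd_add_right (Dvd.intro_left (x i) rfl)).1 (h4 ▸ Dvd.intro_left _ rfl)
      rcases (Nat.Prime.dvd_mul hp).1 h5 with h6 | h6
      · exact absurd (Nat.le_of_dvd (by omega) h6) (by omega)
      · exact absurd ((Nat.prime_dvd_prime_iff_eq hp hr).1 h6) (by omega)
    intro i hi j hj e
    simp only [Finset.coe_range, Set.mem_Iio] at hi hj
    rcases lt_trichotomy i j with hl | hl | hl
    · exact absurd e (aux i j hl hj)
    · exact hl
    · exact absurd e.symm (aux j i hl hi)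
  have := Finset.card_le_card_of_injOn (s := Finset.range (p - 1)) y
    (fun i hi => hS i (Finset.mem_range.1 hi)) hinj
  simpa using this

theorem forward_pos (p q r m : ℕ) (hp : p.Prime) (hq : q.Prime) (hr : r.Prime)
    (hp3 : 3 ≤ p) (hpq : p < q) (hqr : q < r)
    (h : ∀ i < p - 1, (cyclotomic (p * q) ℤ).coeff (m + i * r) = 1) :
    q % p = p - 1 ∧ r % p = p - 1 := by
  obtain ⟨μ, l, hμ1, hμ, hl1, hl, hml⟩ := exists_mu p q hp hq hpq
  have hh : ∀ i : ℕ, ∃ x y, i < p - 1 → x < μ ∧ y < l ∧ m + i * r = x * p + y * q := by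
    intro i
    by_cases hi : i < p - 1
    · obtain ⟨x, y, hxy⟩ := (phi_coeff_pm p q μ l hp hq hpq hμ hl.le hml _).2.1.1 (h i hi)
      exact ⟨x, y, fun _ => hxy⟩
    · exact ⟨0, 0, fun h => absurd h hi⟩
  choose x y hxy using hh
  have hc := card_room p q r m 0 x y (Finset.range l) hp hr (by omega)
    (fun i hi => by simpa using (hxy i hi).2.2) (fun i hi => by simpa using (hxy i hi).2.1)
  rw [Finset.card_range] at hc
  have hl' : l = p - 1 := by omega
  have hμp : μ * p = q + 1 := by
    have : p * q = (p - 1) * q + q := by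
      rw [← Nat.succ_mul]; congr 1; omega
    rw [hl'] at hml; omega
  have hq1 : (q + 1) % p = 0 := by rw [← hμp]; simp
  have hx : ∀ i < p - 1, x i * p + p ≤ q + 1 := by
    intro i hi
    rw [← hμp, ← Nat.succ_mul]
    exact Nat.mul_le_mul_right p (hxy i hi).1
  have hap := ap_div p q r m y (fun i => x i * p) hp3 hqr
    (fun i hi => by rw [(hxy i hi).2.2, add_comm])
    (fun i hi => by have := hx i hi; omega) (fun i hi => by have := hxy i hi; omega)
  have hrq : r % p = q % p := by
    have := congrArg (· % p) hap
    simpa [Nat.add_mod] using this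
  have hqm : q % p = p - 1 := by
    have h1 := Nat.mod_lt q hp.pos
    have h2 := Nat.div_add_mod q p
    rw [Nat.add_mod, Nat.mod_eq_of_lt (a := 1) hp.one_lt] at hq1
    by_contra hc
    rw [Nat.mod_eq_of_lt (by omega)] at hq1
    omega
  exact ⟨hqm, hrq.trans hqm⟩

theorem forward_neg (p q r m : ℕ) (hp : p.Prime) (hq : q.Prime) (hr : r.Prime)
    (hp3 : 3 ≤ p) (hpq : p < q) (hqr : q < r)
    (h : ∀ i < p - 1, (cyclotomic (p * q) ℤ).coeff (m + i * r) = -1) :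
    q % p = 1 ∧ r % p = 1 := by
  obtain ⟨μ, l, hμ1, hμ, hl1, hl, hml⟩ := exists_mu p q hp hq hpq
  have hh : ∀ i : ℕ, ∃ x y, i < p - 1 →
      μ ≤ x ∧ x < q ∧ l ≤ y ∧ y < p ∧ m + i * r + p * q = x * p + y * q := by
    intro i
    by_cases hi : i < p - 1
    · obtain ⟨x, y, hxy⟩ := (phi_coeff_pm p q μ l hp hq hpq hμ hl.le hml _).2.2.1 (h i hi)
      exact ⟨x, y, fun _ => hxy⟩
    · exact ⟨0, 0, fun h => absurd h hi⟩
  choose x y hxy using hh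
  have hc := card_room p q r m (p * q) x y (Finset.Ico l p) hp hr (by omega)
    (fun i hi => (hxy i hi).2.2.2.2)
    (fun i hi => by have := hxy i hi; rw [Finset.mem_Ico]; omega)
  rw [Nat.card_Ico] at hc
  have hl' : l = 1 := by omega
  rw [hl', one_mul] at hml
  obtain ⟨d, hd⟩ := Nat.exists_eq_add_of_le hμ
  have hdp : d * p + 1 = q := by
    have : p * q = μ * p + d * p := by rw [hd]; ring
    omega
  have hpq' : p * q = μ * p + d * p := by rw [hd]; ring
  have hx : ∀ i < p - 1, x i * p + p ≤ p * q ∧ μ * p ≤ x i * p := by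
    intro i hi
    refine ⟨?_, Nat.mul_le_mul_right p (hxy i hi).1⟩
    rw [← Nat.succ_mul, mul_comm p q]
    exact Nat.mul_le_mul_right p (hxy i hi).2.1
  have hap := ap_div p q r m (fun i => y i - 1) (fun i => x i * p - μ * p + 1) hp3 hqr
    (fun i hi => by
      have h1 := hx i hi
      have h2 := hxy i hi
      have h3 : y i * q = (y i - 1) * q + q := by
        rw [← Nat.succ_mul]; congr 1; omega
      omega)
    (fun i hi => by have := hx i hi; omega)
    (fun i hi => by have := hxy i hi; omega)
  have h0 := hx 0 (by omega)
  have h1 := hx 1 (by omega)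
  have hap' : r + x 0 * p = q + x 1 * p := by omega
  have hrq : r % p = q % p := by
    have := congrArg (· % p) hap'
    simpa [Nat.add_mod] using this
  have hqm : q % p = 1 := by
    rw [← hdp, Nat.add_mod]; simp [Nat.mod_eq_of_lt hp.one_lt]
  exact ⟨hqm, hrq.trans hqm⟩

theorem backward_pos (p q r : ℕ) (hp : p.Prime) (hq : q.Prime)
    (hp3 : 3 ≤ p) (hpq : p < q) (hqr : q < r) (hqm : q % p = p - 1) (hrm : r % p = p - 1)
    (hs : (p - 2) * r < (p - 1) * (q - 1)) :
    ∀ i < p - 1, (cyclotomic (p * q) ℤ).coeff (0 + i * r) = 1 := by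
  have hq1 := Nat.div_add_mod q p
  have hr1 := Nat.div_add_mod r p
  rw [hqm] at hq1; rw [hrm] at hr1
  generalize q / p = a at *
  generalize r / p = b at *
  have hab : a ≤ b := by
    by_contra hc
    have : p * b ≤ p * a := Nat.mul_le_mul_left p (by omega)
    omega
  obtain ⟨e, rfl⟩ := Nat.exists_eq_add_of_le hab
  have hre : r = q + p * e := by rw [← hr1, ← hq1]; ring
  have hml : (a + 1) * p + (p - 1) * q = p * q + 1 := by
    have h1 : p * q = (p - 1) * q + q := by
      rw [← Nat.succ_mul]; congr 1; omega
    have h2 : (a + 1) * p = p * a + p := by ring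
    omega
  intro i hi
  have hμ : a + 1 ≤ q := by nlinarith
  refine (phi_coeff_pm p q (a + 1) (p - 1) hp hq hpq hμ (by omega) hml _).2.1.2
    ⟨i * e, i, ?_, hi, by rw [hre]; ring⟩
  have h1 : i * e ≤ (p - 2) * e := Nat.mul_le_mul_right e (by omega)
  refine lt_of_le_of_lt h1 ?_
  obtain ⟨c, rfl⟩ : ∃ c, p = c + 2 := ⟨p - 2, by omega⟩
  obtain ⟨Q, rfl⟩ : ∃ Q, q = Q + 1 := ⟨q - 1, by omega⟩
  simp only [Nat.add_sub_cancel, show c + 2 - 1 = c + 1 by omega] at hs hq1 ⊢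
  rw [hre] at hs
  by_contra hc
  have h3 : (c + 2) * (a + 1) ≤ (c + 2) * (c * e) := Nat.mul_le_mul_left _ (by omega)
  nlinarith

theorem backward_neg (p q r : ℕ) (hp : p.Prime) (hq : q.Prime)
    (hp3 : 3 ≤ p) (hpq : p < q) (hqr : q < r) (hqm : q % p = 1) (hrm : r % p = 1)
    (hs : (p - 2) * r < (p - 1) * (q - 1)) :
    ∀ i < p - 1, (cyclotomic (p * q) ℤ).coeff (1 + i * r) = -1 := by
  have hq1 := Nat.div_add_mod q p
  have hr1 := Nat.div_add_mod r p
  rw [hqm] at hq1; rw [hrm] at hr1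
  generalize q / p = a at *
  generalize r / p = b at *
  have hab : a ≤ b := by
    by_contra hc
    have : p * b ≤ p * a := Nat.mul_le_mul_left p (by omega)
    omega
  obtain ⟨e, rfl⟩ := Nat.exists_eq_add_of_le hab
  have hre : r = q + p * e := by rw [← hr1, ← hq1]; ring
  have haq : a ≤ q := by nlinarith
  obtain ⟨μ, hμ⟩ := Nat.exists_eq_add_of_le haq
  have hml : μ * p + 1 * q = p * q + 1 := by
    have h1 : p * q = p * a + μ * p := by rw [hμ]; ring
    omega
  intro i hi
  have h1 : i * e ≤ (p - 2) * e := Nat.mul_le_mul_right e (by omega)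
  have h2 : (p - 2) * e < a := by
    obtain ⟨c, rfl⟩ : ∃ c, p = c + 2 := ⟨p - 2, by omega⟩
    obtain ⟨Q, rfl⟩ : ∃ Q, q = Q + 1 := ⟨q - 1, by omega⟩
    simp only [Nat.add_sub_cancel, show c + 2 - 1 = c + 1 by omega] at hs hq1 ⊢
    rw [hre] at hs
    by_contra hc
    have h3 : (c + 2) * a ≤ (c + 2) * (c * e) := Nat.mul_le_mul_left _ (by omega)
    nlinarith
  refine (phi_coeff_pm p q μ 1 hp hq hpq (by omega) (by omega) hml _).2.2.2
    ⟨μ + i * e, i + 1, by omega, by omega, by omega, by omega, ?_⟩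
  rw [hre]
  linear_combination -hml

theorem real_ineq (p q r : ℕ) (hp3 : 3 ≤ p) (hpq : p < q) :
    (r : ℝ) < (((p : ℝ) - 1) / ((p : ℝ) - 2)) * ((q : ℝ) - 1) ↔
      (p - 2) * r < (p - 1) * (q - 1) := by
  obtain ⟨c, rfl⟩ : ∃ c, p = c + 2 := ⟨p - 2, by omega⟩
  obtain ⟨Q, rfl⟩ : ∃ Q, q = Q + 1 := ⟨q - 1, by omega⟩
  simp only [Nat.add_sub_cancel, show c + 2 - 1 = c + 1 by omega]
  have hc : (0:ℝ) < c := by exact_mod_cast (by omega : 0 < c)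
  push_cast
  rw [show ((c:ℝ) + 2 - 2) = c by ring, show ((c:ℝ) + 2 - 1) = c + 1 by ring,
    show ((Q:ℝ) + 1 - 1) = Q by ring, div_mul_eq_mul_div, lt_div_iff₀ hc, mul_comm (r:ℝ)]
  exact_mod_cast Iff.rfl

theorem invCyclotomic_height (p q r : ℕ) (hp : p.Prime) (hq : q.Prime) (hr : r.Prime)
    (hp3 : 3 ≤ p) (hpq : p < q) (hqr : q < r) :
    (polyHeight (invCyclotomic (p * q * r)) = p - 1 ↔
      (((q % p = 1 ∧ r % p = 1) ∨ (q % p = p - 1 ∧ r % p = p - 1)) ∧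
        (r : ℝ) < (((p : ℝ) - 1) / ((p : ℝ) - 2)) * ((q : ℝ) - 1))) ∧
    (¬ (((q % p = 1 ∧ r % p = 1) ∨ (q % p = p - 1 ∧ r % p = p - 1)) ∧
        (r : ℝ) < (((p : ℝ) - 1) / ((p : ℝ) - 2)) * ((q : ℝ) - 1)) →
      polyHeight (invCyclotomic (p * q * r)) < p - 1) := by
  have hcoef : ∀ k, ((invCyclotomic (p * q * r)).coeff k).natAbs =
      |∑ j ∈ Finset.range (q + p), gco p q r k j| := by
    intro k
    rw [invCyclotomic, psi_coeff p q r hp hq hr hpq hqr, Int.natCast_natAbs, abs_neg]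
  have hle : polyHeight (invCyclotomic (p * q * r)) ≤ p - 1 := by
    refine Finset.sup_le fun k _ => ?_
    have := psi_le p q r k hp hq hpq hqr
    rw [← hcoef] at this
    exact_mod_cast this
  have hiff : polyHeight (invCyclotomic (p * q * r)) = p - 1 ↔
      ∃ k, |∑ j ∈ Finset.range (q + p), gco p q r k j| = ((p - 1 : ℕ) : ℤ) := by
    constructor
    · intro h
      have hne : (invCyclotomic (p * q * r)).support.Nonempty := by
        rw [Finset.nonempty_iff_ne_empty]
        intro he
        rw [polyHeight, he, Finset.sup_empty] at h
        simp only [Nat.bot_eq_zero] at h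
        omega
      obtain ⟨k, _, hk⟩ := Finset.exists_mem_eq_sup _ hne
        (fun k => ((invCyclotomic (p * q * r)).coeff k).natAbs)
      refine ⟨k, ?_⟩
      rw [← hcoef, ← hk, ← h]; rfl
    · rintro ⟨k, hk⟩
      rw [← hcoef] at hk
      have hk' : ((invCyclotomic (p * q * r)).coeff k).natAbs = p - 1 := by exact_mod_cast hk
      refine le_antisymm hle ?_
      rw [← hk']
      refine Finset.le_sup (f := fun k => ((invCyclotomic (p * q * r)).coeff k).natAbs) ?_
      rw [mem_support_iff]
      intro h0
      rw [h0] at hk'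
      simp only [Int.natAbs_zero] at hk'
      omega
  rw [real_ineq p q r hp3 hpq]
  have main : polyHeight (invCyclotomic (p * q * r)) = p - 1 ↔
      (((q % p = 1 ∧ r % p = 1) ∨ (q % p = p - 1 ∧ r % p = p - 1)) ∧
        (p - 2) * r < (p - 1) * (q - 1)) := by
    rw [hiff]
    constructor
    · rintro ⟨k, hk⟩
      obtain ⟨m, h | h⟩ := psi_eq p q r k hp hq hp3 hpq hqr hk
      · exact ⟨Or.inr (forward_pos p q r m hp hq hr hp3 hpq hqr h),
          size_bound p q r m hp hq hr hp3 hpq hqr (by rw [h _ (by omega)]; norm_num)⟩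
      · exact ⟨Or.inl (forward_neg p q r m hp hq hr hp3 hpq hqr h),
          size_bound p q r m hp hq hr hp3 hpq hqr (by rw [h _ (by omega)]; norm_num)⟩
    · rintro ⟨⟨h1, h2⟩ | ⟨h1, h2⟩, hs⟩
      · exact psi_eq_conv p q r 1 (-1) (by norm_num) hp hq hp3 hpq hqr
          (backward_neg p q r hp hq hp3 hpq hqr h1 h2 hs)
      · exact psi_eq_conv p q r 0 1 (by norm_num) hp hq hp3 hpq hqr
          (backward_pos p q r hp hq hp3 hpq hqr h1 h2 hs)
  exact ⟨main, fun hn => lt_of_le_of_ne hle fun h => hn (main.1 h)⟩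
end

section
/- (Kaplan) Let p < q be primes and let r be a prime with r ≡ 1 (mod pq) or r ≡ -1 (mod pq). Then the cyclotomic polynomial Φ_{pqr} is flat, i.e. h(Φ_{pqr}) = 1. -/
open Classical in
/-- Indicator function of the numerical semigroup generated by `p` and `q`. -/
noncomputable def chi (p q : ℕ) (t : ℤ) : ℤ :=
  if ∃ a b : ℕ, t = a * p + b * q then 1 else 0

/-- Heaviside function. -/
def hv (t : ℤ) : ℤ := if 0 ≤ t then 1 else 0

/-- One period of the coefficients of `1 / Φ_{pq}`. -/
def gg (p q : ℕ) (t : ℤ) : ℤ := hv t - hv (t - p) - hv (t - q) + hv (t - p - q)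

/-- Periodic coefficients of `1 / Φ_{pq}`. -/
def cc (p q : ℕ) (t : ℤ) : ℤ := gg p q (t % ((p : ℤ) * q))

lemma chi_zero_or_one (p q : ℕ) (t : ℤ) : chi p q t = 0 ∨ chi p q t = 1 := by
  unfold chi; split_ifs <;> simp

lemma chi_neg (p q : ℕ) (t : ℤ) (ht : t < 0) : chi p q t = 0 := by
  unfold chi
  rw [if_neg]
  rintro ⟨a, b, h⟩
  have : (0 : ℤ) ≤ a * p + b * q := by positivity
  omega

lemma chi_eq_one {p q : ℕ} {t : ℤ} (h : ∃ a b : ℕ, t = a * p + b * q) : chi p q t = 1 := by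
  unfold chi; rw [if_pos h]

lemma chi_large (p q : ℕ) (hp : 0 < p) (hq : 0 < q) (hc : Nat.Coprime p q) (t : ℤ)
    (ht : (p : ℤ) * q - p - q < t) : chi p q t = 1 := by
  apply chi_eq_one
  obtain ⟨p, rfl⟩ : ∃ k, p = k + 1 := ⟨p - 1, by omega⟩
  obtain ⟨q, rfl⟩ : ∃ k, q = k + 1 := ⟨q - 1, by omega⟩
  have h0 : (p : ℤ) * q ≤ t := by push_cast at ht; linarith
  have h1 : (0 : ℤ) ≤ t := le_trans (by positivity) h0
  lift t to ℕ using h1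
  obtain ⟨a, b, h⟩ := Nat.exists_add_mul_eq_of_gcd_dvd_of_mul_pred_le (p + 1) (q + 1) t
    (by rw [hc.gcd_eq_one]; simp) (by simpa using by exact_mod_cast h0)
  exact ⟨a, b, by exact_mod_cast h.symm⟩

lemma chi_mono_p (p q : ℕ) (t : ℤ) : chi p q (t - p) ≤ chi p q t := by
  rcases chi_zero_or_one p q (t - p) with h | h
  · rcases chi_zero_or_one p q t with h' | h' <;> omega
  · have : ∃ a b : ℕ, t - p = a * p + b * q := by
      by_contra hh
      unfold chi at h
      rw [if_neg hh] at h
      omega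
    obtain ⟨a, b, hab⟩ := this
    rw [h, chi_eq_one ⟨a + 1, b, by push_cast; linarith⟩]

lemma chi_comm (p q : ℕ) (t : ℤ) : chi p q t = chi q p t := by
  unfold chi
  congr 1
  apply propext
  constructor <;> rintro ⟨a, b, h⟩ <;> exact ⟨b, a, by linarith⟩

lemma chi_mono_q (p q : ℕ) (t : ℤ) : chi p q (t - q) ≤ chi p q t := by
  rw [chi_comm p q, chi_comm p q]; exact chi_mono_p q p t

open Classical in
lemma chi_diff (p q : ℕ) (hp : 0 < p) (hq : 0 < q) (hc : Nat.Coprime p q) (t : ℤ) :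
    chi p q t - chi p q (t - p) = if ∃ b : ℕ, b < p ∧ t = b * q then 1 else 0 := by
  split_ifs with h
  · obtain ⟨b, hb, rfl⟩ := h
    rw [chi_eq_one ⟨0, b, by simp⟩]
    have : chi p q ((b : ℤ) * q - p) = 0 := by
      unfold chi
      rw [if_neg]
      rintro ⟨a, b', h⟩
      have h1 : ((a : ℤ) + 1) * p = (b - b') * q := by linarith
      have h2 : (p : ℤ) ∣ (b - b') * q := ⟨a + 1, by linarith⟩
      have h3 : (p : ℤ) ∣ (b - b' : ℤ) :=
        (Nat.isCoprime_iff_coprime.mpr hc).dvd_of_dvd_mul_right h2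
      have h4 : (0 : ℤ) < (b - b') * q := by rw [← h1]; positivity
      have h5 : (0 : ℤ) < b - b' := by
        by_contra hcon
        push Not at hcon
        have := mul_nonpos_of_nonpos_of_nonneg hcon (by positivity : (0 : ℤ) ≤ q)
        omega
      have := Int.le_of_dvd h5 h3
      omega
    rw [this]; rfl
  · have hm := chi_mono_p p q t
    rcases chi_zero_or_one p q t with h1 | h1 <;>
      rcases chi_zero_or_one p q (t - p) with h2 | h2
    · omega
    · omega
    · exfalso
      have : ∃ a b : ℕ, t = a * p + b * q := by
        by_contra hh
        unfold chi at h1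
        rw [if_neg hh] at h1
        omega
      obtain ⟨a, b, hab⟩ := this
      have h3 : ¬ ∃ a b : ℕ, t - p = a * p + b * q := by
        intro hh
        rw [chi_eq_one hh] at h2
        omega
      rcases Nat.eq_zero_or_pos a with rfl | ha
      · by_cases hb : b < p
        · exact h ⟨b, hb, by simpa using hab⟩
        · push Not at hb
          obtain ⟨k, rfl⟩ := Nat.exists_eq_add_of_le hb
          obtain ⟨q, rfl⟩ : ∃ k, q = k + 1 := ⟨q - 1, by omega⟩
          exact h3 ⟨q, k, by rw [hab]; push_cast; ring⟩
      · obtain ⟨a, rfl⟩ : ∃ k, a = k + 1 := ⟨a - 1, by omega⟩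
        exact h3 ⟨a, b, by rw [hab]; push_cast; ring⟩
    · omega

lemma chi_rel (p q : ℕ) (hp : 0 < p) (hq : 0 < q) (hc : Nat.Coprime p q) (t : ℤ) :
    chi p q t - chi p q (t - p) - chi p q (t - q) + chi p q (t - p - q) =
      (if t = 0 then 1 else 0) - (if t = (p : ℤ) * q then 1 else 0) := by
  have h1 := chi_diff p q hp hq hc t
  have h2 := chi_diff p q hp hq hc (t - q)
  rw [show t - q - p = t - p - q by ring] at h2
  have hpq : (0 : ℤ) < (p : ℤ) * q := by positivity
  have key : chi p q t - chi p q (t - p) - chi p q (t - q) + chi p q (t - p - q)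
    = (chi p q t - chi p q (t - p)) - (chi p q (t - q) - chi p q (t - p - q)) := by ring
  rw [key, h1, h2]
  by_cases h0 : t = 0
  · subst h0
    rw [if_pos ⟨0, hp, by simp⟩, if_neg, if_pos rfl, if_neg (by omega)]
    rintro ⟨b, hb, h⟩
    have : (0 : ℤ) ≤ b * q := by positivity
    omega
  · by_cases h3 : t = p * q
    · subst h3
      rw [if_neg, if_pos, if_neg (by omega), if_pos rfl]
      · exact ⟨p - 1, by omega, by push_cast [Nat.cast_sub hp]; ring⟩
      · rintro ⟨b, hb, h⟩
        have : (p : ℤ) = b := mul_right_cancel₀ (by positivity) h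
        omega
    · rw [if_neg h0, if_neg h3, sub_self, sub_eq_zero]
      congr 1
      apply propext
      constructor
      · rintro ⟨b, hb, h⟩
        have : b ≠ 0 := by rintro rfl; simp at h; omega
        obtain ⟨b, rfl⟩ : ∃ k, b = k + 1 := ⟨b - 1, by omega⟩
        exact ⟨b, by omega, by rw [h]; push_cast; ring⟩
      · rintro ⟨b, hb, h⟩
        have h' : t = ((b + 1 : ℕ) : ℤ) * q := by push_cast; linarith
        refine ⟨b + 1, ?_, h'⟩
        by_contra hcon
        have : b + 1 = p := by omega
        rw [this] at h'
        exact h3 h'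

lemma sum_chi (p q : ℕ) (K : ℕ) (v : ℤ) :
    ∑ j ∈ Finset.range K, (chi p q j - chi p q (j - 1)) * hv (v - j)
      = chi p q (min v ((K : ℤ) - 1)) := by
  induction K with
  | zero => simp; rw [chi_neg]; omega
  | succ K ih =>
    rw [Finset.sum_range_succ, ih]
    unfold hv
    split_ifs with h
    · rw [min_eq_right (by omega), min_eq_right (by push_cast; omega)]
      push_cast
      ring_nf
    · rw [min_eq_left (by omega), min_eq_left (by push_cast; omega)]
      ring

/-- The combination of truncated indicator values. -/
noncomputable def EE (p q : ℕ) (L N : ℤ) : ℤ :=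
  chi p q (min N L) - chi p q (min (N - p) L) - chi p q (min (N - q) L)
    + chi p q (min (N - p - q) L)

lemma sum_gg (p q : ℕ) (K : ℕ) (N : ℤ) :
    ∑ j ∈ Finset.range K, (chi p q j - chi p q (j - 1)) * gg p q (N - j)
      = EE p q ((K : ℤ) - 1) N := by
  unfold EE
  rw [← sum_chi, ← sum_chi, ← sum_chi, ← sum_chi, ← Finset.sum_sub_distrib,
    ← Finset.sum_sub_distrib, ← Finset.sum_add_distrib]
  apply Finset.sum_congr rfl
  intro j _
  unfold gg
  rw [show N - j - p = N - p - j by ring, show N - j - q = N - q - j by ring,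
    show N - p - j - q = N - p - q - j by ring]
  ring

lemma chi_min (p q : ℕ) (v L : ℤ) :
    chi p q (min v L) = if v ≤ L then chi p q v else chi p q L := by
  split_ifs with h
  · rw [min_eq_left h]
  · rw [min_eq_right (by omega)]

lemma EE_bound (p q : ℕ) (hp : 0 < p) (hpq : p < q) (hc : Nat.Coprime p q) (L N : ℤ)
    (hN : 0 < N) (hN' : N < (p : ℤ) * q) : |EE p q L N| ≤ 1 := by
  have h := chi_rel p q hp (by omega) hc N
  rw [if_neg (by omega), if_neg (by omega)] at h
  have h1 := chi_mono_p p q N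
  have h2 := chi_mono_q p q N
  have h3 := chi_mono_q p q (N - p)
  have h4 := chi_mono_p p q (N - q)
  rw [show N - q - p = N - p - q by ring] at h4
  unfold EE
  rw [chi_min, chi_min, chi_min, chi_min, abs_le]
  have e0 := chi_zero_or_one p q N
  have e1 := chi_zero_or_one p q (N - p)
  have e2 := chi_zero_or_one p q (N - q)
  have e3 := chi_zero_or_one p q (N - p - q)
  have e4 := chi_zero_or_one p q L
  generalize chi p q N = x0 at *
  generalize chi p q (N - p) = x1 at *
  generalize chi p q (N - q) = x2 at *
  generalize chi p q (N - p - q) = x3 at *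
  generalize chi p q L = x4 at *
  split_ifs <;> omega

lemma EE_zero (p q : ℕ) (hp : 0 < p) (hpq : p < q) (hc : Nat.Coprime p q) (L N : ℤ)
    (hN : (p : ℤ) * q < N) : EE p q L N = 0 := by
  unfold EE
  have key : ∀ v : ℤ, (p : ℤ) * q - p - q < v →
      chi p q (min v L) = if (p : ℤ) * q - p - q < L then 1 else chi p q L := by
    intro v hv
    split_ifs with h
    · exact chi_large p q hp (by omega) hc _ (lt_min hv h)
    · rw [min_eq_right (by omega)]
  rw [key _ (by omega), key _ (by omega), key _ (by omega), key _ (by omega)]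
  ring

lemma EE_edge (p q : ℕ) (hp : 0 < p) (hpq : p < q) (hc : Nat.Coprime p q) (L : ℤ) :
    |EE p q L 0 + EE p q L ((p : ℤ) * q)| ≤ 1 := by
  have h := chi_rel p q hp (by omega) hc ((p : ℤ) * q)
  have hpos : (0 : ℤ) < (p : ℤ) * q := by
    have : 0 < q := by omega
    positivity
  rw [if_neg (by omega), if_pos rfl] at h
  have e0 := chi_zero_or_one p q ((p : ℤ) * q)
  have e1 : chi p q ((p : ℤ) * q - p) = 1 := chi_large p q hp (by omega) hc _ (by omega)
  have e2 : chi p q ((p : ℤ) * q - q) = 1 := chi_large p q hp (by omega) hc _ (by omega)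
  have e3 : chi p q ((p : ℤ) * q) = 1 := chi_large p q hp (by omega) hc _ (by omega)
  have e4 := chi_zero_or_one p q L
  have e5 := chi_zero_or_one p q (min 0 L)
  have e6 : (p : ℤ) * q - p - q < L → chi p q L = 1 := chi_large p q hp (by omega) hc L
  unfold EE
  rw [chi_neg p q (min (0 - p) L) (by omega), chi_neg p q (min (0 - q) L) (by omega),
    chi_neg p q (min (0 - p - q) L) (by omega)]
  rw [chi_min p q ((p : ℤ) * q), chi_min p q ((p : ℤ) * q - p),
    chi_min p q ((p : ℤ) * q - q), chi_min p q ((p : ℤ) * q - p - q), abs_le]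
  generalize chi p q ((p : ℤ) * q) = x0 at *
  generalize chi p q ((p : ℤ) * q - p) = x1 at *
  generalize chi p q ((p : ℤ) * q - q) = x2 at *
  generalize chi p q ((p : ℤ) * q - p - q) = x3 at *
  generalize chi p q L = x4 at *
  generalize chi p q (min 0 L) = x5 at *
  generalize (p : ℤ) * q = P at *
  split_ifs <;> omega

lemma gg_supp (p q : ℕ) (P t : ℤ) (hP : (p : ℤ) + q ≤ P) (ht : t < 0 ∨ P ≤ t) :
    gg p q t = 0 := by
  unfold gg hv
  split_ifs <;> omega

lemma cc_split (p q : ℕ) (hP : (p : ℤ) + q ≤ (p : ℤ) * q) (t : ℤ) (h1 : -((p : ℤ) * q) < t)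
    (h2 : t < (p : ℤ) * q) : cc p q t = gg p q t + gg p q (t + (p : ℤ) * q) := by
  unfold cc
  by_cases h : 0 ≤ t
  · rw [Int.emod_eq_of_lt h h2, gg_supp p q _ (t + (p : ℤ) * q) hP (by omega), add_zero]
  · rw [← Int.add_emod_right, Int.emod_eq_of_lt (by omega) (by omega),
      gg_supp p q _ t hP (by omega), zero_add]

lemma cc_congr (p q : ℕ) (s t : ℤ) (h : s ≡ t [ZMOD (p : ℤ) * q]) : cc p q s = cc p q t := by
  unfold cc; rw [h]

lemma hv_neg (t : ℤ) : hv (-1 - t) = 1 - hv t := by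
  unfold hv
  split_ifs <;> omega

lemma gg_reflect (p q : ℕ) (s : ℤ) : gg p q (p + q - 1 - s) = - gg p q s := by
  unfold gg
  rw [show (p : ℤ) + q - 1 - s = -1 - (s - p - q) by ring,
    show -1 - (s - p - q) - (p : ℤ) = -1 - (s - q) by ring,
    show -1 - (s - p - q) - (q : ℤ) = -1 - (s - p) by ring,
    show -1 - (s - q) - (q : ℤ) = -1 - s by ring, hv_neg, hv_neg, hv_neg, hv_neg]
  ring

lemma cc_reflect (p q : ℕ) (hp : 0 < p) (hP : (p : ℤ) + q ≤ (p : ℤ) * q)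
    (hP0 : 0 < (p : ℤ) * q) (t : ℤ) :
    cc p q (p + q - 1 - t) = - cc p q t := by
  have h0 := Int.emod_nonneg t hP0.ne'
  have h1 := Int.emod_lt_of_pos t hP0
  have e1 : cc p q (p + q - 1 - t) = cc p q (p + q - 1 - t % ((p : ℤ) * q)) :=
    cc_congr _ _ _ _ (Int.ModEq.sub rfl (Int.mod_modEq _ _).symm)
  have e2 : cc p q t = gg p q (t % ((p : ℤ) * q)) := rfl
  rw [e1, e2]
  generalize t % ((p : ℤ) * q) = s at *
  rw [cc_split p q hP _ (by omega) (by omega), gg_reflect,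
    gg_supp p q ((p : ℤ) + q) (p + q - 1 - s + (p : ℤ) * q) le_rfl (by omega), add_zero]

lemma sum_cc_bound (p q : ℕ) (hp : 0 < p) (hpq : p < q) (hc : Nat.Coprime p q)
    (hP : (p : ℤ) + q ≤ (p : ℤ) * q) (K : ℕ) (hK : K ≤ p * q) (N : ℤ) :
    |∑ j ∈ Finset.range K, (chi p q j - chi p q (j - 1)) * cc p q (N - j)| ≤ 1 := by
  have hP0 : 0 < (p : ℤ) * q := by omega
  have h0 := Int.emod_nonneg N hP0.ne'
  have h1 := Int.emod_lt_of_pos N hP0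
  have hK' : (K : ℤ) ≤ (p : ℤ) * q := by exact_mod_cast hK
  have : ∑ j ∈ Finset.range K, (chi p q j - chi p q (j - 1)) * cc p q (N - j)
      = EE p q ((K : ℤ) - 1) (N % ((p : ℤ) * q))
        + EE p q ((K : ℤ) - 1) (N % ((p : ℤ) * q) + (p : ℤ) * q) := by
    rw [← sum_gg, ← sum_gg, ← Finset.sum_add_distrib]
    apply Finset.sum_congr rfl
    intro j hj
    have hj' := Finset.mem_range.mp hj
    rw [cc_congr p q (N - j) (N % ((p : ℤ) * q) - j)
      (Int.ModEq.sub (Int.mod_modEq _ _).symm rfl), cc_split p q hP _ (by omega) (by omega)]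
    rw [show N % ((p : ℤ) * q) - j + (p : ℤ) * q = N % ((p : ℤ) * q) + (p : ℤ) * q - j by ring]
    ring
  rw [this]
  generalize N % ((p : ℤ) * q) = M at *
  rcases h0.eq_or_lt with h | h
  · rw [← h, zero_add]
    exact EE_edge p q hp hpq hc _
  · rw [EE_zero p q hp hpq hc _ (M + (p : ℤ) * q) (by omega), add_zero]
    exact EE_bound p q hp hpq hc _ _ h h1

lemma mk_shift (f : ℤ → ℤ) (hf : ∀ t < 0, f t = 0) (k : ℕ) :
    (PowerSeries.mk fun n : ℕ => f n) * PowerSeries.X ^ k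
      = PowerSeries.mk fun n : ℕ => f ((n : ℤ) - k) := by
  ext n
  rw [PowerSeries.coeff_mul_X_pow']
  simp only [PowerSeries.coeff_mk]
  split_ifs with h
  · rw [Nat.cast_sub h]
  · rw [hf]; omega

lemma mk_shift2 (f : ℤ → ℤ) (hf : ∀ t < 0, f t = 0) (p q : ℕ) :
    (PowerSeries.mk fun n : ℕ => f n) * ((1 - PowerSeries.X ^ p) * (1 - PowerSeries.X ^ q))
      = PowerSeries.mk fun n : ℕ => f n - f ((n : ℤ) - p) - f ((n : ℤ) - q)
        + f ((n : ℤ) - p - q) := by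
  have h1 := mk_shift f hf p
  have h2 := mk_shift f hf q
  have h3 := mk_shift f hf (p + q)
  have : (PowerSeries.mk fun n : ℕ => f n) *
      ((1 - PowerSeries.X ^ p) * (1 - PowerSeries.X ^ q)) =
      (PowerSeries.mk fun n : ℕ => f n) - (PowerSeries.mk fun n : ℕ => f n) * PowerSeries.X ^ p
      - (PowerSeries.mk fun n : ℕ => f n) * PowerSeries.X ^ q
      + (PowerSeries.mk fun n : ℕ => f n) * PowerSeries.X ^ (p + q) := by ring
  rw [this, h1, h2, h3]
  ext n
  simp [sub_sub]

lemma one_sub_X_pow_ne (k : ℕ) (hk : 0 < k) : (1 - PowerSeries.X ^ k : PowerSeries ℤ) ≠ 0 := by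
  intro h
  have := congrArg (PowerSeries.coeff 0) h
  rw [map_sub, PowerSeries.coeff_X_pow] at this
  simp [hk.ne] at this

lemma mk_chi (p q : ℕ) (hp : 0 < p) (hq : 0 < q) (hc : Nat.Coprime p q) :
    (PowerSeries.mk fun n : ℕ => chi p q n) *
      ((1 - PowerSeries.X ^ p) * (1 - PowerSeries.X ^ q)) = 1 - PowerSeries.X ^ (p * q) := by
  rw [mk_shift2 _ (chi_neg p q)]
  ext n
  rw [PowerSeries.coeff_mk, chi_rel p q hp hq hc, map_sub, PowerSeries.coeff_X_pow,
    PowerSeries.coeff_one]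
  norm_cast

lemma mk_gg (p q : ℕ) :
    (PowerSeries.mk fun n : ℕ => gg p q n) * (1 - PowerSeries.X) =
      (1 - PowerSeries.X ^ p) * (1 - PowerSeries.X ^ q) := by
  have h := mk_shift2 hv (fun t ht => by unfold hv; rw [if_neg (by omega)]) p q
  have h1 : (PowerSeries.mk fun n : ℕ => hv n) = PowerSeries.mk (1 : ℕ → ℤ) := by
    ext n; simp [hv]
  have h2 : (PowerSeries.mk fun n : ℕ => gg p q n) =
    PowerSeries.mk (1 : ℕ → ℤ) * ((1 - PowerSeries.X ^ p) * (1 - PowerSeries.X ^ q)) := by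
    rw [← h1, h]; rfl
  rw [h2, mul_right_comm, PowerSeries.mk_one_mul_one_sub_eq_one, one_mul]

lemma mk_cc (p q : ℕ) (hP : (p : ℤ) + q ≤ (p : ℤ) * q) :
    (PowerSeries.mk fun n : ℕ => cc p q n) * (1 - PowerSeries.X ^ (p * q)) =
      PowerSeries.mk fun n : ℕ => gg p q n := by
  ext n
  rw [mul_sub, mul_one, map_sub, PowerSeries.coeff_mul_X_pow']
  simp only [PowerSeries.coeff_mk]
  split_ifs with h
  · have h' : (p : ℤ) * q ≤ n := by exact_mod_cast h
    rw [gg_supp p q _ n hP (by omega), sub_eq_zero]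
    apply cc_congr
    rw [Nat.cast_sub h]
    push_cast
    exact (Int.sub_emod_right _ _).symm
  · have h' : (n : ℤ) < (p : ℤ) * q := by exact_mod_cast not_le.mp h
    unfold cc
    rw [Int.emod_eq_of_lt (by omega) h', sub_zero]

open Polynomial in
lemma cyc_pq (p q : ℕ) (hp : p.Prime) (hq : q.Prime) (hpq : p < q) :
    cyclotomic (p * q) ℤ * ((X ^ p - 1) * (X ^ q - 1)) = (X ^ (p * q) - 1) * (X - 1) := by
  have := Fact.mk hp
  have h1 := cyclotomic_prime_mul_X_sub_one ℤ p
  have h2 := cyclotomic_expand_eq_cyclotomic_mul hq (n := p)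
    (fun h => absurd (Nat.le_of_dvd hp.pos h) (by omega)) ℤ
  have h3 := congrArg (expand ℤ q) h1
  simp only [map_mul, map_sub, map_pow, expand_X, map_one, h2] at h3
  rw [← pow_mul, mul_comm q p] at h3
  rw [← h1, ← h3]
  ring

lemma cyc_pq' (p q : ℕ) (hp : p.Prime) (hq : q.Prime) (hpq : p < q) :
    ((Polynomial.cyclotomic (p * q) ℤ : Polynomial ℤ) : PowerSeries ℤ) *
      ((1 - PowerSeries.X ^ p) * (1 - PowerSeries.X ^ q)) =
      (1 - PowerSeries.X ^ (p * q)) * (1 - PowerSeries.X) := by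
  have h := congrArg (fun f : Polynomial ℤ => (f : PowerSeries ℤ)) (cyc_pq p q hp hq hpq)
  simp only [Polynomial.coe_mul, Polynomial.coe_sub, Polynomial.coe_pow, Polynomial.coe_X,
    Polynomial.coe_one] at h
  linear_combination h

lemma cyc_coeff (p q : ℕ) (hp : p.Prime) (hq : q.Prime) (hpq : p < q) (j : ℕ) :
    (Polynomial.cyclotomic (p * q) ℤ).coeff j = chi p q j - chi p q (j - 1) := by
  have hc : Nat.Coprime p q := (Nat.coprime_primes hp hq).mpr hpq.ne
  have h : ((Polynomial.cyclotomic (p * q) ℤ : Polynomial ℤ) : PowerSeries ℤ) =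
      (PowerSeries.mk fun n : ℕ => chi p q n) * (1 - PowerSeries.X) := by
    apply mul_right_cancel₀ (mul_ne_zero (one_sub_X_pow_ne p hp.pos) (one_sub_X_pow_ne q hq.pos))
    rw [cyc_pq' p q hp hq hpq, mul_right_comm, mk_chi p q hp.pos hq.pos hc]
  have h1 := mk_shift (chi p q) (chi_neg p q) 1
  rw [pow_one] at h1
  rw [mul_sub, mul_one, h1] at h
  rw [← Polynomial.coeff_coe, h]
  simp

lemma cyc_inv (p q : ℕ) (hp : p.Prime) (hq : q.Prime) (hpq : p < q)
    (hP : (p : ℤ) + q ≤ (p : ℤ) * q) :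
    ((Polynomial.cyclotomic (p * q) ℤ : Polynomial ℤ) : PowerSeries ℤ) *
      (PowerSeries.mk fun n : ℕ => cc p q n) = 1 := by
  have h1 := one_sub_X_pow_ne 1 one_pos
  rw [pow_one] at h1
  apply mul_right_cancel₀ (mul_ne_zero (one_sub_X_pow_ne (p * q) (mul_pos hp.pos hq.pos)) h1)
  have e1 := cyc_pq' p q hp hq hpq
  have e2 := mk_gg p q
  rw [← mk_cc p q hP] at e2
  rw [one_mul]
  nth_rewrite 2 [← e1]
  rw [← e2]
  ring

lemma coeff_expand_mul (P : Polynomial ℤ) (r B : ℕ) (hr : 0 < r) (hB : P.natDegree < B)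
    (c : ℤ → ℤ) (n : ℕ) :
    PowerSeries.coeff n (((Polynomial.expand ℤ r P : Polynomial ℤ) : PowerSeries ℤ) *
      (PowerSeries.mk fun n : ℕ => c n)) =
    ∑ j ∈ Finset.range (min (n / r + 1) B), P.coeff j * c ((n : ℤ) - r * j) := by
  have hE : ((Polynomial.expand ℤ r P : Polynomial ℤ) : PowerSeries ℤ) =
      ∑ j ∈ Finset.range B, PowerSeries.C (P.coeff j) * PowerSeries.X ^ (r * j) := by
    conv_lhs => rw [P.as_sum_range' B hB]
    rw [map_sum, ← Polynomial.coeToPowerSeries.ringHom_apply, map_sum]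
    apply Finset.sum_congr rfl
    intro j _
    rw [Polynomial.expand_monomial, Polynomial.coeToPowerSeries.ringHom_apply,
      Polynomial.coe_monomial, mul_comm r j]
    ext m
    rw [PowerSeries.coeff_C_mul, PowerSeries.coeff_X_pow, PowerSeries.coeff_monomial]
    simp
  rw [hE, Finset.sum_mul, map_sum]
  have : ∀ j, PowerSeries.coeff n (PowerSeries.C (P.coeff j) * PowerSeries.X ^ (r * j) *
      (PowerSeries.mk fun n : ℕ => c n)) =
      if j < n / r + 1 then P.coeff j * c ((n : ℤ) - r * j) else 0 := by
    intro j
    rw [mul_assoc, PowerSeries.coeff_C_mul, PowerSeries.coeff_X_pow_mul', PowerSeries.coeff_mk]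
    have : r * j ≤ n ↔ j < n / r + 1 := by
      rw [Nat.lt_succ_iff, Nat.le_div_iff_mul_le hr, mul_comm]
    by_cases h : r * j ≤ n
    · rw [if_pos h, if_pos (this.mp h), Nat.cast_sub h]; push_cast; rfl
    · rw [if_neg h, if_neg (fun h' => h (this.mpr h')), mul_zero]
  simp only [this]
  rw [← Finset.sum_filter]
  apply Finset.sum_congr _ (fun _ _ => rfl)
  ext j
  simp
  tauto

theorem kaplan_flat (p q r : ℕ) (hp : p.Prime) (hq : q.Prime) (hr : r.Prime)
    (hpq : p < q) (hmod : r % (p * q) = 1 ∨ r % (p * q) = p * q - 1) :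
    polyHeight (Polynomial.cyclotomic (p * q * r) ℤ) = 1 := by
  have hc : Nat.Coprime p q := (Nat.coprime_primes hp hq).mpr hpq.ne
  have hp2 := hp.two_le
  have hPn : p + q < p * q := by nlinarith
  have hP : (p : ℤ) + q ≤ (p : ℤ) * q := by exact_mod_cast hPn.le
  have hP0 : 0 < (p : ℤ) * q := by omega
  have hrpq : ¬ r ∣ p * q := by
    intro h
    have hlt : r = p ∨ r = q := by
      rcases (Nat.Prime.dvd_mul hr).mp h with h | h
      · exact Or.inl ((Nat.prime_dvd_prime_iff_eq hr hp).mp h)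
      · exact Or.inr ((Nat.prime_dvd_prime_iff_eq hr hq).mp h)
    have := hr.two_le
    rw [Nat.mod_eq_of_lt (by omega)] at hmod
    omega
  have hexp := Polynomial.cyclotomic_expand_eq_cyclotomic_mul hr hrpq ℤ
  have hdeg : (Polynomial.cyclotomic (p * q) ℤ).natDegree < p * q := by
    rw [Polynomial.natDegree_cyclotomic]
    exact Nat.totient_lt _ (by omega)
  have hps : ((Polynomial.cyclotomic (p * q * r) ℤ : Polynomial ℤ) : PowerSeries ℤ) =
      ((Polynomial.expand ℤ r (Polynomial.cyclotomic (p * q) ℤ) : Polynomial ℤ) :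
        PowerSeries ℤ) * (PowerSeries.mk fun n : ℕ => cc p q n) := by
    rw [hexp, Polynomial.coe_mul, mul_assoc (Polynomial.cyclotomic (p * q * r) ℤ : PowerSeries ℤ), cyc_inv p q hp hq hpq hP, mul_one]
  have hbound : ∀ n, |(Polynomial.cyclotomic (p * q * r) ℤ).coeff n| ≤ 1 := by
    intro n
    rw [← Polynomial.coeff_coe, hps, coeff_expand_mul _ r (p * q) hr.pos hdeg]
    simp only [cyc_coeff p q hp hq hpq]
    have hr' : (r : ℤ) = (p : ℤ) * q * (r / (p * q) : ℕ) + (r % (p * q) : ℕ) := by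
      exact_mod_cast (Nat.div_add_mod r (p * q)).symm
    rcases hmod with hm | hm
    · have h := sum_cc_bound p q hp.pos hpq hc hP _ (min_le_right (n / r + 1) (p * q)) n
      convert h using 4 with j hj
      apply cc_congr
      rw [hm] at hr'
      apply (Int.modEq_iff_dvd).mpr
      exact ⟨(r / (p * q) : ℕ) * j, by rw [hr']; push_cast; ring⟩
    · have h := sum_cc_bound p q hp.pos hpq hc hP _ (min_le_right (n / r + 1) (p * q))
        (p + q - 1 - n)
      rw [← abs_neg, ← Finset.sum_neg_distrib] at h
      convert h using 3 with j hj
      rw [← mul_neg]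
      congr 1
      rw [show (p : ℤ) + q - 1 - n - j = p + q - 1 - (n + j) by ring,
        cc_reflect p q hp.pos hP hP0, neg_neg]
      apply cc_congr
      rw [hm, Nat.cast_sub (by omega)] at hr'
      apply (Int.modEq_iff_dvd).mpr
      exact ⟨((r / (p * q) : ℕ) + 1) * j, by rw [hr']; push_cast; ring⟩
  unfold polyHeight
  apply le_antisymm
  · apply Finset.sup_le
    intro k _
    have := abs_le.mp (hbound k)
    omega
  · have hmonic := Polynomial.cyclotomic.monic (p * q * r) ℤ
    have hlc : (Polynomial.cyclotomic (p * q * r) ℤ).coeff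
      (Polynomial.cyclotomic (p * q * r) ℤ).natDegree = 1 := hmonic
    have := Finset.le_sup (f := fun k => ((Polynomial.cyclotomic (p * q * r) ℤ).coeff k).natAbs)
      (Polynomial.natDegree_mem_support_of_nonzero hmonic.ne_zero)
    simpa [hlc] using this
end
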